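/- arXiv:2006.15867 — 3 statements merged into one kernel-verified Lean document; each statement's English description precedes it below -/
import Mathlib

section
/- Let T be an invertible block TBT-matrix belonging to the DSTU class. Then for {k,p} = {1,2} with k ≠ p: Γ̂_p^τ = U Γ_p Ũ_k + [0 M_{3p}], where Ũ_k = [[0, −U_k⊗U₃],[U_k⊗U₃, 0]]. -/
open Matrix Kronecker BigOperators

noncomputable section

namespace TBT

/-- The entries `a_r` of the matrices `𝒜_p`. -/
def aEnt (r : ℤ) : ℂ := if r < 0 then 0 else if r = 0 then Complex.I / 2 else Complex.I

/-- The `n × n` matrix `𝒜 = {a_{j-ℓ}}`. -/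
def calA (n : ℕ) : Matrix (Fin n) (Fin n) ℂ :=
  Matrix.of fun j ℓ => aEnt (((j : ℕ) : ℤ) - ((ℓ : ℕ) : ℤ))

/-- The index type of the `m × m` matrices, `m = m₁ m₂ m₃`. -/
abbrev Idx (m₁ m₂ m₃ : ℕ) := (Fin m₁ × Fin m₂) × Fin m₃

/-- `A₁ = 𝒜₁ ⊗ I_{m₂} ⊗ I_{m₃}`. -/
def A1 (m₁ m₂ m₃ : ℕ) : Matrix (Idx m₁ m₂ m₃) (Idx m₁ m₂ m₃) ℂ :=
  (calA m₁ ⊗ₖ (1 : Matrix (Fin m₂) (Fin m₂) ℂ)) ⊗ₖ (1 : Matrix (Fin m₃) (Fin m₃) ℂ)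

/-- `A₂ = I_{m₁} ⊗ 𝒜₂ ⊗ I_{m₃}`. -/
def A2 (m₁ m₂ m₃ : ℕ) : Matrix (Idx m₁ m₂ m₃) (Idx m₁ m₂ m₃) ℂ :=
  ((1 : Matrix (Fin m₁) (Fin m₁) ℂ) ⊗ₖ calA m₂) ⊗ₖ (1 : Matrix (Fin m₃) (Fin m₃) ℂ)

/-- `A₃ = I_{m₁} ⊗ I_{m₂} ⊗ 𝒜₃`. -/
def A3 (m₁ m₂ m₃ : ℕ) : Matrix (Idx m₁ m₂ m₃) (Idx m₁ m₂ m₃) ℂ :=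
  ((1 : Matrix (Fin m₁) (Fin m₁) ℂ) ⊗ₖ (1 : Matrix (Fin m₂) (Fin m₂) ℂ)) ⊗ₖ calA m₃

/-- The block TBT-matrix `T = {𝒯_{i-k}}`, `𝒯_r = {t^{(r)}_{i-k}}`, built from the
data `t : ℤ → ℤ → Matrix (Fin m₃) (Fin m₃) ℂ` of its `m₃ × m₃` blocks. -/
def Tmat (m₁ m₂ m₃ : ℕ) (t : ℤ → ℤ → Matrix (Fin m₃) (Fin m₃) ℂ) :
    Matrix (Idx m₁ m₂ m₃) (Idx m₁ m₂ m₃) ℂ :=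
  Matrix.of fun x y =>
    t (((x.1.1 : ℕ) : ℤ) - ((y.1.1 : ℕ) : ℤ)) (((x.1.2 : ℕ) : ℤ) - ((y.1.2 : ℕ) : ℤ)) x.2 y.2

/-- The Toeplitz blocks `𝒯_r = {t^{(r)}_{i-k}}` of a block TBT-matrix. -/
def calT (m₂ m₃ : ℕ) (t : ℤ → ℤ → Matrix (Fin m₃) (Fin m₃) ℂ) (r : ℤ) :
    Matrix (Fin m₂ × Fin m₃) (Fin m₂ × Fin m₃) ℂ :=
  Matrix.of fun x y => t r (((x.1 : ℕ) : ℤ) - ((y.1 : ℕ) : ℤ)) x.2 y.2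

/-- `M₁₁ = col [M₁₁⁽¹⁾ … M₁₁⁽ᵐ¹⁾]`, `M₁₁⁽ⁱ⁾ = (1/2)𝒯₀ + Σ_{s=1}^{i-1} 𝒯_s`. -/
def M11 (m₁ m₂ m₃ : ℕ) (t : ℤ → ℤ → Matrix (Fin m₃) (Fin m₃) ℂ) :
    Matrix (Idx m₁ m₂ m₃) (Fin m₂ × Fin m₃) ℂ :=
  Matrix.of fun x y =>
    ((2 : ℂ)⁻¹ • calT m₂ m₃ t 0 +
      ∑ s ∈ Finset.range (x.1.1 : ℕ), calT m₂ m₃ t ((s : ℤ) + 1)) (x.1.2, x.2) y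

/-- `M₂₁ = 1_{m₁}^* ⊗ I_{m₂ m₃}`. -/
def M21 (m₁ m₂ m₃ : ℕ) : Matrix (Fin m₂ × Fin m₃) (Idx m₁ m₂ m₃) ℂ :=
  Matrix.of fun y x => if y.1 = x.1.2 ∧ y.2 = x.2 then 1 else 0

/-- `M₃₁ = M₂₁^*`. -/
def M31 (m₁ m₂ m₃ : ℕ) : Matrix (Idx m₁ m₂ m₃) (Fin m₂ × Fin m₃) ℂ := (M21 m₁ m₂ m₃)ᴴ

/-- `M₄₁ = [M₄₁⁽¹⁾ … M₄₁⁽ᵐ¹⁾]`, `M₄₁⁽ᵏ⁾ = (1/2)𝒯₀ + Σ_{s=1}^{k-1} 𝒯_{-s}`. -/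
def M41 (m₁ m₂ m₃ : ℕ) (t : ℤ → ℤ → Matrix (Fin m₃) (Fin m₃) ℂ) :
    Matrix (Fin m₂ × Fin m₃) (Idx m₁ m₂ m₃) ℂ :=
  Matrix.of fun y x =>
    ((2 : ℂ)⁻¹ • calT m₂ m₃ t 0 +
      ∑ s ∈ Finset.range (x.1.1 : ℕ), calT m₂ m₃ t (-((s : ℤ) + 1))) y (x.1.2, x.2)

/-- The blocks `M₁₂⁽ʳ⁾ = col [(1/2)t₀⁽ʳ⁾, (1/2)t₀⁽ʳ⁾ + t₁⁽ʳ⁾, …]`. -/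
def M12blk (m₂ m₃ : ℕ) (t : ℤ → ℤ → Matrix (Fin m₃) (Fin m₃) ℂ) (r : ℤ) :
    Matrix (Fin m₂ × Fin m₃) (Fin m₃) ℂ :=
  Matrix.of fun x l =>
    ((2 : ℂ)⁻¹ • t r 0 + ∑ j ∈ Finset.range (x.1 : ℕ), t r ((j : ℤ) + 1)) x.2 l

/-- `M₁₂ = {M₁₂^{(i-k)}}_{i,k=1}^{m₁}`. -/
def M12 (m₁ m₂ m₃ : ℕ) (t : ℤ → ℤ → Matrix (Fin m₃) (Fin m₃) ℂ) :
    Matrix (Idx m₁ m₂ m₃) (Fin m₁ × Fin m₃) ℂ :=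
  Matrix.of fun x y => M12blk m₂ m₃ t (((x.1.1 : ℕ) : ℤ) - ((y.1 : ℕ) : ℤ)) (x.1.2, x.2) y.2

/-- `M₂₂ = I_{m₁} ⊗ 1_{m₂}^* ⊗ I_{m₃}`. -/
def M22 (m₁ m₂ m₃ : ℕ) : Matrix (Fin m₁ × Fin m₃) (Idx m₁ m₂ m₃) ℂ :=
  Matrix.of fun y x => if y.1 = x.1.1 ∧ y.2 = x.2 then 1 else 0

/-- `M₃₂ = M₂₂^*`. -/
def M32 (m₁ m₂ m₃ : ℕ) : Matrix (Idx m₁ m₂ m₃) (Fin m₁ × Fin m₃) ℂ := (M22 m₁ m₂ m₃)ᴴ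

/-- The blocks `M₄₂⁽ʳ⁾ = [(1/2)t₀⁽ʳ⁾, (1/2)t₀⁽ʳ⁾ + t₋₁⁽ʳ⁾, …]`. -/
def M42blk (m₂ m₃ : ℕ) (t : ℤ → ℤ → Matrix (Fin m₃) (Fin m₃) ℂ) (r : ℤ) :
    Matrix (Fin m₃) (Fin m₂ × Fin m₃) ℂ :=
  Matrix.of fun l x =>
    ((2 : ℂ)⁻¹ • t r 0 + ∑ j ∈ Finset.range (x.1 : ℕ), t r (-((j : ℤ) + 1))) l x.2

/-- `M₄₂ = {M₄₂^{(i-k)}}_{i,k=1}^{m₁}`. -/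
def M42 (m₁ m₂ m₃ : ℕ) (t : ℤ → ℤ → Matrix (Fin m₃) (Fin m₃) ℂ) :
    Matrix (Fin m₁ × Fin m₃) (Idx m₁ m₂ m₃) ℂ :=
  Matrix.of fun y x => M42blk m₂ m₃ t (((y.1 : ℕ) : ℤ) - ((x.1.1 : ℕ) : ℤ)) y.2 (x.1.2, x.2)

/-- `Π₁ = [M₁₁ M₃₁]`. -/
def Pi1 (m₁ m₂ m₃ : ℕ) (t : ℤ → ℤ → Matrix (Fin m₃) (Fin m₃) ℂ) :
    Matrix (Idx m₁ m₂ m₃) ((Fin m₂ × Fin m₃) ⊕ (Fin m₂ × Fin m₃)) ℂ :=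
  Matrix.fromCols (M11 m₁ m₂ m₃ t) (M31 m₁ m₂ m₃)

/-- `Π₂ = [M₁₂ M₃₂]`. -/
def Pi2 (m₁ m₂ m₃ : ℕ) (t : ℤ → ℤ → Matrix (Fin m₃) (Fin m₃) ℂ) :
    Matrix (Idx m₁ m₂ m₃) ((Fin m₁ × Fin m₃) ⊕ (Fin m₁ × Fin m₃)) ℂ :=
  Matrix.fromCols (M12 m₁ m₂ m₃ t) (M32 m₁ m₂ m₃)

/-- `Π̂₁ = col [M₂₁; M₄₁]`. -/
def Pihat1 (m₁ m₂ m₃ : ℕ) (t : ℤ → ℤ → Matrix (Fin m₃) (Fin m₃) ℂ) :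
    Matrix ((Fin m₂ × Fin m₃) ⊕ (Fin m₂ × Fin m₃)) (Idx m₁ m₂ m₃) ℂ :=
  Matrix.fromRows (M21 m₁ m₂ m₃) (M41 m₁ m₂ m₃ t)

/-- `Π̂₂ = col [M₂₂; M₄₂]`. -/
def Pihat2 (m₁ m₂ m₃ : ℕ) (t : ℤ → ℤ → Matrix (Fin m₃) (Fin m₃) ℂ) :
    Matrix ((Fin m₁ × Fin m₃) ⊕ (Fin m₁ × Fin m₃)) (Idx m₁ m₂ m₃) ℂ :=
  Matrix.fromRows (M22 m₁ m₂ m₃) (M42 m₁ m₂ m₃ t)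

/-- `Γ₁ = T⁻¹ Π₁`. -/
def Gamma1 (m₁ m₂ m₃ : ℕ) (t : ℤ → ℤ → Matrix (Fin m₃) (Fin m₃) ℂ) :
    Matrix (Idx m₁ m₂ m₃) ((Fin m₂ × Fin m₃) ⊕ (Fin m₂ × Fin m₃)) ℂ :=
  (Tmat m₁ m₂ m₃ t)⁻¹ * Pi1 m₁ m₂ m₃ t

/-- `Γ₂ = T⁻¹ Π₂`. -/
def Gamma2 (m₁ m₂ m₃ : ℕ) (t : ℤ → ℤ → Matrix (Fin m₃) (Fin m₃) ℂ) :
    Matrix (Idx m₁ m₂ m₃) ((Fin m₁ × Fin m₃) ⊕ (Fin m₁ × Fin m₃)) ℂ :=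
  (Tmat m₁ m₂ m₃ t)⁻¹ * Pi2 m₁ m₂ m₃ t

/-- `Γ̂₁ = Π̂₁ T⁻¹`. -/
def Gammahat1 (m₁ m₂ m₃ : ℕ) (t : ℤ → ℤ → Matrix (Fin m₃) (Fin m₃) ℂ) :
    Matrix ((Fin m₂ × Fin m₃) ⊕ (Fin m₂ × Fin m₃)) (Idx m₁ m₂ m₃) ℂ :=
  Pihat1 m₁ m₂ m₃ t * (Tmat m₁ m₂ m₃ t)⁻¹

/-- `Γ̂₂ = Π̂₂ T⁻¹`. -/
def Gammahat2 (m₁ m₂ m₃ : ℕ) (t : ℤ → ℤ → Matrix (Fin m₃) (Fin m₃) ℂ) :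
    Matrix ((Fin m₁ × Fin m₃) ⊕ (Fin m₁ × Fin m₃)) (Idx m₁ m₂ m₃) ℂ :=
  Pihat2 m₁ m₂ m₃ t * (Tmat m₁ m₂ m₃ t)⁻¹

/-- `ℒ = 1_{m₁m₂} ⊗ I_{m₃}`. -/
def Lmat (m₁ m₂ m₃ : ℕ) : Matrix (Idx m₁ m₂ m₃) (Fin m₃) ℂ :=
  Matrix.of fun x l => if x.2 = l then 1 else 0

/-- `ℒ_p = 1_{m_p} ⊗ I_{m₃}`. -/
def Lp (n m₃ : ℕ) : Matrix (Fin n × Fin m₃) (Fin m₃) ℂ :=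
  Matrix.of fun x l => if x.2 = l then 1 else 0

/-- A row vector `v` Kronecker the identity `I_{m₃}`. -/
def rowKronId {n : Type*} (m₃ : ℕ) (v : n → ℂ) : Matrix (Fin m₃) (n × Fin m₃) ℂ :=
  Matrix.of fun l x => v x.1 * (if l = x.2 then 1 else 0)

/-- A column vector `v` Kronecker the identity `I_{m₃}`. -/
def colKronId {n : Type*} (m₃ : ℕ) (v : n → ℂ) : Matrix (n × Fin m₃) (Fin m₃) ℂ :=
  Matrix.of fun x l => v x.1 * (if x.2 = l then 1 else 0)

/-- `ω(λ,μ) = ℒ^* (A₁^*-μ₁I)⁻¹ (A₂^*-μ₂I)⁻¹ T⁻¹ (A₁-λ₁I)⁻¹ (A₂-λ₂I)⁻¹ ℒ`. -/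
def omegaF (m₁ m₂ m₃ : ℕ) (t : ℤ → ℤ → Matrix (Fin m₃) (Fin m₃) ℂ) (l₁ l₂ mu₁ mu₂ : ℂ) :
    Matrix (Fin m₃) (Fin m₃) ℂ :=
  (Lmat m₁ m₂ m₃)ᴴ * ((A1 m₁ m₂ m₃)ᴴ - mu₁ • 1)⁻¹ * ((A2 m₁ m₂ m₃)ᴴ - mu₂ • 1)⁻¹ *
    (Tmat m₁ m₂ m₃ t)⁻¹ * (A1 m₁ m₂ m₃ - l₁ • 1)⁻¹ * (A2 m₁ m₂ m₃ - l₂ • 1)⁻¹ *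
    Lmat m₁ m₂ m₃

/-- `v₁(μ) = ℒ^* (A₁^*-μ₁I)⁻¹ (A₂^*-μ₂I)⁻¹ Γ₁`. -/
def v1 (m₁ m₂ m₃ : ℕ) (t : ℤ → ℤ → Matrix (Fin m₃) (Fin m₃) ℂ) (mu₁ mu₂ : ℂ) :
    Matrix (Fin m₃) ((Fin m₂ × Fin m₃) ⊕ (Fin m₂ × Fin m₃)) ℂ :=
  (Lmat m₁ m₂ m₃)ᴴ * ((A1 m₁ m₂ m₃)ᴴ - mu₁ • 1)⁻¹ * ((A2 m₁ m₂ m₃)ᴴ - mu₂ • 1)⁻¹ *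
    Gamma1 m₁ m₂ m₃ t

/-- `v₂(μ) = ℒ^* (A₁^*-μ₁I)⁻¹ (A₂^*-μ₂I)⁻¹ Γ₂`. -/
def v2 (m₁ m₂ m₃ : ℕ) (t : ℤ → ℤ → Matrix (Fin m₃) (Fin m₃) ℂ) (mu₁ mu₂ : ℂ) :
    Matrix (Fin m₃) ((Fin m₁ × Fin m₃) ⊕ (Fin m₁ × Fin m₃)) ℂ :=
  (Lmat m₁ m₂ m₃)ᴴ * ((A1 m₁ m₂ m₃)ᴴ - mu₁ • 1)⁻¹ * ((A2 m₁ m₂ m₃)ᴴ - mu₂ • 1)⁻¹ *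
    Gamma2 m₁ m₂ m₃ t

/-- `v̂₁(λ) = Γ̂₁ (A₁-λ₁I)⁻¹ (A₂-λ₂I)⁻¹ ℒ`. -/
def vhat1 (m₁ m₂ m₃ : ℕ) (t : ℤ → ℤ → Matrix (Fin m₃) (Fin m₃) ℂ) (l₁ l₂ : ℂ) :
    Matrix ((Fin m₂ × Fin m₃) ⊕ (Fin m₂ × Fin m₃)) (Fin m₃) ℂ :=
  Gammahat1 m₁ m₂ m₃ t * (A1 m₁ m₂ m₃ - l₁ • 1)⁻¹ * (A2 m₁ m₂ m₃ - l₂ • 1)⁻¹ * Lmat m₁ m₂ m₃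

/-- `v̂₂(λ) = Γ̂₂ (A₁-λ₁I)⁻¹ (A₂-λ₂I)⁻¹ ℒ`. -/
def vhat2 (m₁ m₂ m₃ : ℕ) (t : ℤ → ℤ → Matrix (Fin m₃) (Fin m₃) ℂ) (l₁ l₂ : ℂ) :
    Matrix ((Fin m₁ × Fin m₃) ⊕ (Fin m₁ × Fin m₃)) (Fin m₃) ℂ :=
  Gammahat2 m₁ m₂ m₃ t * (A1 m₁ m₂ m₃ - l₁ • 1)⁻¹ * (A2 m₁ m₂ m₃ - l₂ • 1)⁻¹ * Lmat m₁ m₂ m₃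

/-- `u₁(μ) = v₁(μ) - i (1_{m₂}^* (𝒜₂^*-μ₂I)⁻¹ ⊗ I_{m₃}) [I_{m₂m₃} 0]`. -/
def u1 (m₁ m₂ m₃ : ℕ) (t : ℤ → ℤ → Matrix (Fin m₃) (Fin m₃) ℂ) (mu₁ mu₂ : ℂ) :
    Matrix (Fin m₃) ((Fin m₂ × Fin m₃) ⊕ (Fin m₂ × Fin m₃)) ℂ :=
  v1 m₁ m₂ m₃ t mu₁ mu₂ -
    Complex.I • Matrix.fromCols
      (rowKronId m₃ (Matrix.vecMul (fun _ : Fin m₂ => (1 : ℂ)) (((calA m₂)ᴴ - mu₂ • 1)⁻¹))) 0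

/-- `u₂(μ) = v₂(μ) - i (1_{m₁}^* (𝒜₁^*-μ₁I)⁻¹ ⊗ I_{m₃}) [I_{m₁m₃} 0]`. -/
def u2 (m₁ m₂ m₃ : ℕ) (t : ℤ → ℤ → Matrix (Fin m₃) (Fin m₃) ℂ) (mu₁ mu₂ : ℂ) :
    Matrix (Fin m₃) ((Fin m₁ × Fin m₃) ⊕ (Fin m₁ × Fin m₃)) ℂ :=
  v2 m₁ m₂ m₃ t mu₁ mu₂ -
    Complex.I • Matrix.fromCols
      (rowKronId m₃ (Matrix.vecMul (fun _ : Fin m₁ => (1 : ℂ)) (((calA m₁)ᴴ - mu₁ • 1)⁻¹))) 0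

/-- `û₁(λ) = v̂₁(λ) + i col[0; I_{m₂m₃}] ((𝒜₂-λ₂I)⁻¹ 1_{m₂} ⊗ I_{m₃})`. -/
def uhat1 (m₁ m₂ m₃ : ℕ) (t : ℤ → ℤ → Matrix (Fin m₃) (Fin m₃) ℂ) (l₁ l₂ : ℂ) :
    Matrix ((Fin m₂ × Fin m₃) ⊕ (Fin m₂ × Fin m₃)) (Fin m₃) ℂ :=
  vhat1 m₁ m₂ m₃ t l₁ l₂ +
    Complex.I • Matrix.fromRows 0
      (colKronId m₃ (Matrix.mulVec ((calA m₂ - l₂ • 1)⁻¹) (fun _ : Fin m₂ => (1 : ℂ))))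

/-- `û₂(λ) = v̂₂(λ) + i col[0; I_{m₁m₃}] ((𝒜₁-λ₁I)⁻¹ 1_{m₁} ⊗ I_{m₃})`. -/
def uhat2 (m₁ m₂ m₃ : ℕ) (t : ℤ → ℤ → Matrix (Fin m₃) (Fin m₃) ℂ) (l₁ l₂ : ℂ) :
    Matrix ((Fin m₁ × Fin m₃) ⊕ (Fin m₁ × Fin m₃)) (Fin m₃) ℂ :=
  vhat2 m₁ m₂ m₃ t l₁ l₂ +
    Complex.I • Matrix.fromRows 0
      (colKronId m₃ (Matrix.mulVec ((calA m₁ - l₁ • 1)⁻¹) (fun _ : Fin m₁ => (1 : ℂ))))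

/-- `K₁₁ = col [(1/2)M₄₂⁽⁰⁾, (1/2)M₄₂⁽⁰⁾+M₄₂⁽¹⁾, …]`. -/
def K11 (m₁ m₂ m₃ : ℕ) (t : ℤ → ℤ → Matrix (Fin m₃) (Fin m₃) ℂ) :
    Matrix (Fin m₁ × Fin m₃) (Fin m₂ × Fin m₃) ℂ :=
  Matrix.of fun y x =>
    ((2 : ℂ)⁻¹ • M42blk m₂ m₃ t 0 +
      ∑ j ∈ Finset.range (y.1 : ℕ), M42blk m₂ m₃ t ((j : ℤ) + 1)) y.2 x

/-- `K₁₂ = [(1/2)M₁₂⁽⁰⁾, (1/2)M₁₂⁽⁰⁾+M₁₂⁽⁻¹⁾, …]`. -/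
def K12 (m₁ m₂ m₃ : ℕ) (t : ℤ → ℤ → Matrix (Fin m₃) (Fin m₃) ℂ) :
    Matrix (Fin m₂ × Fin m₃) (Fin m₁ × Fin m₃) ℂ :=
  Matrix.of fun y x =>
    ((2 : ℂ)⁻¹ • M12blk m₂ m₃ t 0 +
      ∑ j ∈ Finset.range (x.1 : ℕ), M12blk m₂ m₃ t (-((j : ℤ) + 1))) y x.2

/-- `K = [(1/2)M₄₂⁽⁰⁾, (1/2)M₄₂⁽⁰⁾+M₄₂⁽⁻¹⁾, …]`. -/
def Kmat (m₁ m₂ m₃ : ℕ) (t : ℤ → ℤ → Matrix (Fin m₃) (Fin m₃) ℂ) :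
    Matrix (Fin m₃) (Idx m₁ m₂ m₃) ℂ :=
  Matrix.of fun l x =>
    ((2 : ℂ)⁻¹ • M42blk m₂ m₃ t 0 +
      ∑ j ∈ Finset.range (x.1.1 : ℕ), M42blk m₂ m₃ t (-((j : ℤ) + 1))) l (x.1.2, x.2)

/-- `N = col [(1/2)M₁₂⁽⁰⁾, (1/2)M₁₂⁽⁰⁾+M₁₂⁽¹⁾, …]`. -/
def Nmat (m₁ m₂ m₃ : ℕ) (t : ℤ → ℤ → Matrix (Fin m₃) (Fin m₃) ℂ) :
    Matrix (Idx m₁ m₂ m₃) (Fin m₃) ℂ :=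
  Matrix.of fun x l =>
    ((2 : ℂ)⁻¹ • M12blk m₂ m₃ t 0 +
      ∑ j ∈ Finset.range (x.1.1 : ℕ), M12blk m₂ m₃ t ((j : ℤ) + 1)) (x.1.2, x.2) l

/-- `diag {(𝒜-zI) ⊗ I_{m₃}, (𝒜-zI) ⊗ I_{m₃}}` (the diagonal blocks `G₁₁`, `G₂₂`). -/
def diagKron (n m₃ : ℕ) (z : ℂ) :
    Matrix ((Fin n × Fin m₃) ⊕ (Fin n × Fin m₃)) ((Fin n × Fin m₃) ⊕ (Fin n × Fin m₃)) ℂ :=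
  Matrix.fromBlocks ((calA n - z • 1) ⊗ₖ (1 : Matrix (Fin m₃) (Fin m₃) ℂ)) 0 0
    ((calA n - z • 1) ⊗ₖ (1 : Matrix (Fin m₃) (Fin m₃) ℂ))

/-- `diag {(𝒜^*-zI) ⊗ I_{m₃}, (𝒜^*-zI) ⊗ I_{m₃}}` (the diagonal blocks `E₁₁`, `E₂₂`). -/
def diagKronH (n m₃ : ℕ) (z : ℂ) :
    Matrix ((Fin n × Fin m₃) ⊕ (Fin n × Fin m₃)) ((Fin n × Fin m₃) ⊕ (Fin n × Fin m₃)) ℂ :=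
  Matrix.fromBlocks (((calA n)ᴴ - z • 1) ⊗ₖ (1 : Matrix (Fin m₃) (Fin m₃) ℂ)) 0 0
    (((calA n)ᴴ - z • 1) ⊗ₖ (1 : Matrix (Fin m₃) (Fin m₃) ℂ))

/-- `𝔄(z) = diag {(𝒜^*-zI) ⊗ I_{m₃}, (𝒜-zI) ⊗ I_{m₃}}`. -/
def frakA (n m₃ : ℕ) (z : ℂ) :
    Matrix ((Fin n × Fin m₃) ⊕ (Fin n × Fin m₃)) ((Fin n × Fin m₃) ⊕ (Fin n × Fin m₃)) ℂ :=
  Matrix.fromBlocks (((calA n)ᴴ - z • 1) ⊗ₖ (1 : Matrix (Fin m₃) (Fin m₃) ℂ)) 0 0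
    ((calA n - z • 1) ⊗ₖ (1 : Matrix (Fin m₃) (Fin m₃) ℂ))

/-- `G₁₂ = i (Π̂₁ Γ₂ - [[ℒ₂ℒ₁^*, 0], [K₁₂, 0]])`. -/
def G12 (m₁ m₂ m₃ : ℕ) (t : ℤ → ℤ → Matrix (Fin m₃) (Fin m₃) ℂ) :
    Matrix ((Fin m₂ × Fin m₃) ⊕ (Fin m₂ × Fin m₃)) ((Fin m₁ × Fin m₃) ⊕ (Fin m₁ × Fin m₃)) ℂ :=
  Complex.I • (Pihat1 m₁ m₂ m₃ t * Gamma2 m₁ m₂ m₃ t -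
    Matrix.fromBlocks (Lp m₂ m₃ * (Lp m₁ m₃)ᴴ) 0 (K12 m₁ m₂ m₃ t) 0)

/-- `G₂₁ = i (Π̂₂ Γ₁ - [[ℒ₁ℒ₂^*, 0], [K₁₁, 0]])`. -/
def G21 (m₁ m₂ m₃ : ℕ) (t : ℤ → ℤ → Matrix (Fin m₃) (Fin m₃) ℂ) :
    Matrix ((Fin m₁ × Fin m₃) ⊕ (Fin m₁ × Fin m₃)) ((Fin m₂ × Fin m₃) ⊕ (Fin m₂ × Fin m₃)) ℂ :=
  Complex.I • (Pihat2 m₁ m₂ m₃ t * Gamma1 m₁ m₂ m₃ t -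
    Matrix.fromBlocks (Lp m₁ m₃ * (Lp m₂ m₃)ᴴ) 0 (K11 m₁ m₂ m₃ t) 0)

/-- `G(λ) = [[G₁₁(λ₂), G₁₂], [G₂₁, G₂₂(λ₁)]]`. -/
def Gmat (m₁ m₂ m₃ : ℕ) (t : ℤ → ℤ → Matrix (Fin m₃) (Fin m₃) ℂ) (l₁ l₂ : ℂ) :
    Matrix ((((Fin m₂ × Fin m₃) ⊕ (Fin m₂ × Fin m₃))) ⊕ (((Fin m₁ × Fin m₃) ⊕ (Fin m₁ × Fin m₃))))
      ((((Fin m₂ × Fin m₃) ⊕ (Fin m₂ × Fin m₃))) ⊕ (((Fin m₁ × Fin m₃) ⊕ (Fin m₁ × Fin m₃)))) ℂ :=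
  Matrix.fromBlocks (diagKron m₂ m₃ l₂) (G12 m₁ m₂ m₃ t) (G21 m₁ m₂ m₃ t) (diagKron m₁ m₃ l₁)

/-- `E₁₂ = -i (Π̂₁ Γ₂ - [[0, 0], [K₁₂, ℒ₂ℒ₁^*]])`. -/
def E12m (m₁ m₂ m₃ : ℕ) (t : ℤ → ℤ → Matrix (Fin m₃) (Fin m₃) ℂ) :
    Matrix ((Fin m₂ × Fin m₃) ⊕ (Fin m₂ × Fin m₃)) ((Fin m₁ × Fin m₃) ⊕ (Fin m₁ × Fin m₃)) ℂ :=
  (-Complex.I) • (Pihat1 m₁ m₂ m₃ t * Gamma2 m₁ m₂ m₃ t -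
    Matrix.fromBlocks 0 0 (K12 m₁ m₂ m₃ t) (Lp m₂ m₃ * (Lp m₁ m₃)ᴴ))

/-- `E₂₁ = -i (Π̂₂ Γ₁ - [[0, 0], [K₁₁, ℒ₁ℒ₂^*]])`. -/
def E21m (m₁ m₂ m₃ : ℕ) (t : ℤ → ℤ → Matrix (Fin m₃) (Fin m₃) ℂ) :
    Matrix ((Fin m₁ × Fin m₃) ⊕ (Fin m₁ × Fin m₃)) ((Fin m₂ × Fin m₃) ⊕ (Fin m₂ × Fin m₃)) ℂ :=
  (-Complex.I) • (Pihat2 m₁ m₂ m₃ t * Gamma1 m₁ m₂ m₃ t -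
    Matrix.fromBlocks 0 0 (K11 m₁ m₂ m₃ t) (Lp m₁ m₃ * (Lp m₂ m₃)ᴴ))

/-- `E(μ) = [[E₁₁(μ₂), E₁₂], [E₂₁, E₂₂(μ₁)]]`. -/
def Emat (m₁ m₂ m₃ : ℕ) (t : ℤ → ℤ → Matrix (Fin m₃) (Fin m₃) ℂ) (mu₁ mu₂ : ℂ) :
    Matrix ((((Fin m₂ × Fin m₃) ⊕ (Fin m₂ × Fin m₃))) ⊕ (((Fin m₁ × Fin m₃) ⊕ (Fin m₁ × Fin m₃))))
      ((((Fin m₂ × Fin m₃) ⊕ (Fin m₂ × Fin m₃))) ⊕ (((Fin m₁ × Fin m₃) ⊕ (Fin m₁ × Fin m₃)))) ℂ :=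
  Matrix.fromBlocks (diagKronH m₂ m₃ mu₂) (E12m m₁ m₂ m₃ t) (E21m m₁ m₂ m₃ t) (diagKronH m₁ m₃ mu₁)

/-- `θ(λ) = i (I_{m₃} + K R (A₁-λ₁I)⁻¹ (A₂-λ₂I)⁻¹ ℒ)`. -/
def theta (m₁ m₂ m₃ : ℕ) (t : ℤ → ℤ → Matrix (Fin m₃) (Fin m₃) ℂ) (l₁ l₂ : ℂ) :
    Matrix (Fin m₃) (Fin m₃) ℂ :=
  Complex.I • (1 + Kmat m₁ m₂ m₃ t * (Tmat m₁ m₂ m₃ t)⁻¹ *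
    (A1 m₁ m₂ m₃ - l₁ • 1)⁻¹ * (A2 m₁ m₂ m₃ - l₂ • 1)⁻¹ * Lmat m₁ m₂ m₃)

/-- `ϑ(μ) = -i (I_{m₃} + ℒ^* (A₁^*-μ₁I)⁻¹ (A₂^*-μ₂I)⁻¹ R N)`. -/
def vartheta (m₁ m₂ m₃ : ℕ) (t : ℤ → ℤ → Matrix (Fin m₃) (Fin m₃) ℂ) (mu₁ mu₂ : ℂ) :
    Matrix (Fin m₃) (Fin m₃) ℂ :=
  (-Complex.I) • (1 + (Lmat m₁ m₂ m₃)ᴴ * ((A1 m₁ m₂ m₃)ᴴ - mu₁ • 1)⁻¹ *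
    ((A2 m₁ m₂ m₃)ᴴ - mu₂ • 1)⁻¹ * (Tmat m₁ m₂ m₃ t)⁻¹ * Nmat m₁ m₂ m₃ t)

/-- The exchange (anti-diagonal) matrix `U_n = {δ_{n-i-k+1}}`. -/
def Up (n : ℕ) : Matrix (Fin n) (Fin n) ℂ :=
  Matrix.of fun i k => if (i : ℕ) + (k : ℕ) + 1 = n then 1 else 0

/-- `U = U₁ ⊗ U₂ ⊗ U₃`. -/
def Umat (m₁ m₂ m₃ : ℕ) : Matrix (Idx m₁ m₂ m₃) (Idx m₁ m₂ m₃) ℂ :=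
  (Up m₁ ⊗ₖ Up m₂) ⊗ₖ Up m₃

/-- `Ũ_k = [[0, -(U_k ⊗ U₃)], [U_k ⊗ U₃, 0]]`. -/
def Utilde (n m₃ : ℕ) :
    Matrix ((Fin n × Fin m₃) ⊕ (Fin n × Fin m₃)) ((Fin n × Fin m₃) ⊕ (Fin n × Fin m₃)) ℂ :=
  Matrix.fromBlocks 0 (-(Up n ⊗ₖ Up m₃)) (Up n ⊗ₖ Up m₃) 0

/-- The DSTU property: `U₃ t_j^{(r)} U₃ = (t_j^{(r)})ᵀ` for all blocks. -/
def DSTU (m₃ : ℕ) (t : ℤ → ℤ → Matrix (Fin m₃) (Fin m₃) ℂ) : Prop :=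
  ∀ r j : ℤ, Up m₃ * t r j * Up m₃ = (t r j)ᵀ

/-- `q(μ) = ((μ₁-i/2)/(μ₁+i/2))^{m₁} ((μ₂-i/2)/(μ₂+i/2))^{m₂}`. -/
def qfun (m₁ m₂ : ℕ) (mu₁ mu₂ : ℂ) : ℂ :=
  ((mu₁ - Complex.I / 2) / (mu₁ + Complex.I / 2)) ^ m₁ *
    ((mu₂ - Complex.I / 2) / (mu₂ + Complex.I / 2)) ^ m₂

theorem Up_eq (n : ℕ) (i k : Fin n) : Up n i k = if k = Fin.rev i then 1 else 0 := by
  simp only [Up, Matrix.of_apply]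
  congr 1
  rw [Fin.ext_iff, Fin.val_rev]
  apply propext
  omega

theorem Up_eq' (n : ℕ) (i k : Fin n) : Up n i k = if i = Fin.rev k then 1 else 0 := by
  simp only [Up, Matrix.of_apply]
  congr 1
  rw [Fin.ext_iff, Fin.val_rev]
  apply propext
  omega

/-- reversal of a triple index -/
def rv3 {a b c : ℕ} (x : Idx a b c) : Idx a b c := ((x.1.1.rev, x.1.2.rev), x.2.rev)

/-- reversal of a pair index -/
def rv2 {a c : ℕ} (x : Fin a × Fin c) : Fin a × Fin c := (x.1.rev, x.2.rev)

theorem Umat_eq (a b c : ℕ) (x y : Idx a b c) :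
    Umat a b c x y = if y = rv3 x then 1 else 0 := by
  obtain ⟨⟨x1, x2⟩, x3⟩ := x
  obtain ⟨⟨y1, y2⟩, y3⟩ := y
  simp only [Umat, Matrix.kroneckerMap_apply, Up_eq, rv3, Prod.mk.injEq]
  split_ifs <;> simp_all

theorem Umat_eq' (a b c : ℕ) (x y : Idx a b c) :
    Umat a b c x y = if x = rv3 y then 1 else 0 := by
  obtain ⟨⟨x1, x2⟩, x3⟩ := x
  obtain ⟨⟨y1, y2⟩, y3⟩ := y
  simp only [Umat, Matrix.kroneckerMap_apply, Up_eq', rv3, Prod.mk.injEq]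
  split_ifs <;> simp_all

theorem V_eq' (a c : ℕ) (x y : Fin a × Fin c) :
    (Up a ⊗ₖ Up c) x y = if x = rv2 y then 1 else 0 := by
  obtain ⟨x1, x2⟩ := x
  obtain ⟨y1, y2⟩ := y
  simp only [Matrix.kroneckerMap_apply, Up_eq', rv2, Prod.mk.injEq]
  split_ifs <;> simp_all

theorem U_mul {a b c : ℕ} {κ : Type*} (A : Matrix (Idx a b c) κ ℂ) (x : Idx a b c) (y : κ) :
    (Umat a b c * A) x y = A (rv3 x) y := by
  simp [Matrix.mul_apply, Umat_eq]

theorem mul_U {a b c : ℕ} {κ : Type*} (A : Matrix κ (Idx a b c) ℂ) (x : κ) (y : Idx a b c) :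
    (A * Umat a b c) x y = A x (rv3 y) := by
  simp [Matrix.mul_apply, Umat_eq']

theorem mul_V {a c : ℕ} {κ : Type*} (A : Matrix κ (Fin a × Fin c) ℂ) (x : κ) (y : Fin a × Fin c) :
    (A * (Up a ⊗ₖ Up c)) x y = A x (rv2 y) := by
  simp only [Matrix.mul_apply, V_eq']
  simp

theorem DSTU.apply {c : ℕ} {t : ℤ → ℤ → Matrix (Fin c) (Fin c) ℂ} (h : DSTU c t) (r j : ℤ)
    (x y : Fin c) : t r j x.rev y.rev = t r j y x := by
  have := congrFun (congrFun (h r j) x) y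
  have h2 : ∀ A : Matrix (Fin c) (Fin c) ℂ, (Up c * A * Up c) x y = A x.rev y.rev := by
    intro A
    have h3 : ∀ k, (Up c * A) x k = A x.rev k := by
      intro k
      simp [Matrix.mul_apply, Up_eq]
    rw [Matrix.mul_apply]
    simp only [h3, Up_eq']
    simp
  rwa [h2, Matrix.transpose_apply] at this

theorem U_mul_U (a b c : ℕ) : Umat a b c * Umat a b c = 1 := by
  ext x y
  rw [U_mul, Umat_eq, Matrix.one_apply]
  simp [rv3, eq_comm]

theorem V_mul_V (a c : ℕ) : (Up a ⊗ₖ Up c) * (Up a ⊗ₖ Up c) = 1 := by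
  ext x y
  rw [mul_V, V_eq', Matrix.one_apply]
  simp [rv2]

theorem rev_sub {n : ℕ} (x y : Fin n) :
    (((x.rev : Fin n) : ℕ) : ℤ) - ((y.rev : ℕ) : ℤ) = ((y : ℕ) : ℤ) - ((x : ℕ) : ℤ) := by
  simp only [Fin.val_rev]; omega

theorem UTU (a b c : ℕ) (t : ℤ → ℤ → Matrix (Fin c) (Fin c) ℂ) (hD : DSTU c t) :
    Umat a b c * Tmat a b c t * Umat a b c = (Tmat a b c t)ᵀ := by
  ext x y
  rw [mul_U, U_mul]
  simp only [Tmat, rv3, Matrix.of_apply, Matrix.transpose_apply, hD.apply, rev_sub]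

theorem core {ι κ : Type*} [Fintype ι] [DecidableEq ι] [Fintype κ] [DecidableEq κ]
    (T U : Matrix ι ι ℂ) (V : Matrix κ κ ℂ) (P Q M : Matrix ι κ ℂ)
    (hT : IsUnit T) (hU : U * U = 1) (hV : V * V = 1) (hTU : U * T * U = Tᵀ)
    (hP : U * P = P * V) (hQ : U * Q * V = T * P - M) :
    (fromRows Pᵀ Qᵀ * T⁻¹)ᵀ =
      U * (T⁻¹ * fromCols M P) * fromBlocks 0 (-V) V 0 + fromCols 0 P := by
  have hd := (Matrix.isUnit_iff_isUnit_det T).1 hT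
  have hR : (T⁻¹)ᵀ = U * T⁻¹ * U := by
    rw [Matrix.transpose_nonsing_inv, ← hTU]
    apply Matrix.inv_eq_right_inv
    calc U * T * U * (U * T⁻¹ * U) = U * T * (U * U) * T⁻¹ * U := by simp only [Matrix.mul_assoc]
      _ = 1 := by rw [hU, Matrix.mul_one, Matrix.mul_assoc U, Matrix.mul_nonsing_inv _ hd,
                    Matrix.mul_one, hU]
  have hQ' : U * Q = T * P * V - M * V := by
    rw [← Matrix.sub_mul, ← hQ, Matrix.mul_assoc, hV, Matrix.mul_one]
  have e1 : (T⁻¹)ᵀ * P = U * (T⁻¹ * P) * V := by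
    rw [hR, Matrix.mul_assoc, hP]; simp only [Matrix.mul_assoc]
  have e2 : (T⁻¹)ᵀ * Q = - (U * (T⁻¹ * M) * V) + P := by
    rw [hR, Matrix.mul_assoc, hQ', Matrix.mul_sub, sub_eq_neg_add]
    congr 1
    · simp only [Matrix.mul_assoc]
    · rw [Matrix.mul_assoc T, ← hP, Matrix.mul_assoc U, ← Matrix.mul_assoc T⁻¹,
        Matrix.nonsing_inv_mul _ hd, Matrix.one_mul, ← Matrix.mul_assoc, hU, Matrix.one_mul]
  rw [Matrix.transpose_mul, Matrix.transpose_fromRows, Matrix.transpose_transpose,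
    Matrix.transpose_transpose, Matrix.mul_fromCols, Matrix.mul_fromCols, Matrix.mul_fromCols,
    Matrix.fromCols_mul_fromBlocks, e1, e2]
  ext x (y | y) <;> simp

theorem sum_toep {n : ℕ} (f : ℤ → ℂ) (i : Fin n) :
    ∑ k : Fin n, f (((i : ℕ) : ℤ) - ((k : ℕ) : ℤ)) =
      (2⁻¹ * f 0 + ∑ s ∈ Finset.range (i : ℕ), f ((s : ℤ) + 1)) +
      (2⁻¹ * f 0 + ∑ s ∈ Finset.range (i.rev : ℕ), f (-((s : ℤ) + 1))) := by
  rw [Fin.sum_univ_eq_sum_range (fun k : ℕ => f (((i : ℕ) : ℤ) - (k : ℤ))) n]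
  obtain ⟨i, hi⟩ := i
  simp only [Fin.val_rev]
  obtain ⟨j, rfl⟩ : ∃ j, n = i + 1 + j := ⟨n - (i + 1), by omega⟩
  rw [Finset.sum_range_add, Finset.sum_range_succ, show i + 1 + j - (i + 1) = j by omega,
    ← Finset.sum_range_reflect]
  have h1 : ∑ s ∈ Finset.range i, f ((i : ℤ) - ((i - 1 - s : ℕ) : ℤ)) =
      ∑ s ∈ Finset.range i, f ((s : ℤ) + 1) := by
    refine Finset.sum_congr rfl fun s hs => ?_
    rw [Finset.mem_range] at hs
    congr 1; omega
  have h2 : ∑ s ∈ Finset.range j, f ((i : ℤ) - ((i + 1 + s : ℕ) : ℤ)) =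
      ∑ s ∈ Finset.range j, f (-((s : ℤ) + 1)) := by
    refine Finset.sum_congr rfl fun s hs => ?_
    congr 1; push_cast; ring
  rw [h1, h2, sub_self]
  ring

theorem M31_T (a b c : ℕ) : M21 a b c = (M31 a b c)ᵀ := by
  ext x y
  simp only [M31, M21, Matrix.transpose_apply, Matrix.conjTranspose_apply, Matrix.of_apply]
  split_ifs <;> simp

theorem M32_T (a b c : ℕ) : M22 a b c = (M32 a b c)ᵀ := by
  ext x y
  simp only [M32, M22, Matrix.transpose_apply, Matrix.conjTranspose_apply, Matrix.of_apply]
  split_ifs <;> simp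

theorem rev_eq {n : ℕ} (x y : Fin n) : x.rev = y ↔ x = y.rev := by
  rw [Fin.rev_eq_iff]

theorem U_M31 (a b c : ℕ) : Umat a b c * M31 a b c = M31 a b c * (Up b ⊗ₖ Up c) := by
  ext x y
  rw [U_mul, mul_V]
  simp only [M31, M21, rv2, rv3, Matrix.conjTranspose_apply, Matrix.of_apply, rev_eq, Fin.rev_rev]

theorem U_M32 (a b c : ℕ) : Umat a b c * M32 a b c = M32 a b c * (Up a ⊗ₖ Up c) := by
  ext x y
  rw [U_mul, mul_V]
  simp only [M32, M22, rv2, rv3, Matrix.conjTranspose_apply, Matrix.of_apply, rev_eq, Fin.rev_rev]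

theorem T_M31 (a b c : ℕ) (A : Matrix (Idx a b c) (Idx a b c) ℂ) (x : Idx a b c)
    (y : Fin b × Fin c) : (A * M31 a b c) x y = ∑ k : Fin a, A x ((k, y.1), y.2) := by
  rw [← Matrix.transpose_transpose (M31 a b c), ← M31_T]
  simp only [Matrix.mul_apply, Matrix.transpose_apply, M21, Matrix.of_apply, Fintype.sum_prod_type,
    ite_and, mul_ite, mul_one, mul_zero]
  simp

theorem T_M32 (a b c : ℕ) (A : Matrix (Idx a b c) (Idx a b c) ℂ) (x : Idx a b c)
    (y : Fin a × Fin c) : (A * M32 a b c) x y = ∑ k : Fin b, A x ((y.1, k), y.2) := by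
  rw [← Matrix.transpose_transpose (M32 a b c), ← M32_T]
  simp only [Matrix.mul_apply, Matrix.transpose_apply, M22, Matrix.of_apply, Fintype.sum_prod_type,
    ite_and, mul_ite, mul_one, mul_zero]
  rw [Finset.sum_comm]
  simp

theorem Q1 (a b c : ℕ) (t : ℤ → ℤ → Matrix (Fin c) (Fin c) ℂ) (hD : DSTU c t) :
    Umat a b c * (M41 a b c t)ᵀ * (Up b ⊗ₖ Up c) =
      Tmat a b c t * M31 a b c - M11 a b c t := by
  ext x y
  rw [mul_V, U_mul, Matrix.sub_apply, T_M31]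
  simp only [M41, M11, Tmat, calT, rv2, rv3, Matrix.of_apply, Matrix.transpose_apply,
    Matrix.add_apply, Matrix.smul_apply, Matrix.sum_apply, smul_eq_mul, hD.apply, rev_sub]
  rw [sum_toep (fun r => t r (((x.1.2 : ℕ) : ℤ) - ((y.1 : ℕ) : ℤ)) x.2 y.2) x.1.1]
  ring

theorem Q2 (a b c : ℕ) (t : ℤ → ℤ → Matrix (Fin c) (Fin c) ℂ) (hD : DSTU c t) :
    Umat a b c * (M42 a b c t)ᵀ * (Up a ⊗ₖ Up c) =
      Tmat a b c t * M32 a b c - M12 a b c t := by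
  ext x y
  rw [mul_V, U_mul, Matrix.sub_apply, T_M32]
  simp only [M42, M12, M42blk, M12blk, Tmat, rv2, rv3, Matrix.of_apply, Matrix.transpose_apply,
    Matrix.add_apply, Matrix.smul_apply, Matrix.sum_apply, smul_eq_mul, hD.apply, rev_sub]
  rw [sum_toep (fun r => t (((x.1.1 : ℕ) : ℤ) - ((y.1 : ℕ) : ℤ)) r x.2 y.2) x.1.2]
  ring

/-- For an invertible DSTU block TBT-matrix `T`,
`Γ̂_pᵀ = U Γ_p Ũ_k + [0 M_{3p}]` for `{k, p} = {1, 2}`, `k ≠ p`. -/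
theorem statement16 (m₁ m₂ m₃ : ℕ) (hm₁ : 2 ≤ m₁) (hm₂ : 2 ≤ m₂) (hm₃ : 2 ≤ m₃)
    (t : ℤ → ℤ → Matrix (Fin m₃) (Fin m₃) ℂ) (hD : DSTU m₃ t)
    (hT : IsUnit (Tmat m₁ m₂ m₃ t)) :
    (Gammahat1 m₁ m₂ m₃ t)ᵀ =
      Umat m₁ m₂ m₃ * Gamma1 m₁ m₂ m₃ t * Utilde m₂ m₃ +
        Matrix.fromCols 0 (M31 m₁ m₂ m₃) ∧
    (Gammahat2 m₁ m₂ m₃ t)ᵀ =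
      Umat m₁ m₂ m₃ * Gamma2 m₁ m₂ m₃ t * Utilde m₁ m₃ +
        Matrix.fromCols 0 (M32 m₁ m₂ m₃) := by
  constructor
  · have := core _ _ _ _ (M41 m₁ m₂ m₃ t)ᵀ _ hT (U_mul_U m₁ m₂ m₃) (V_mul_V m₂ m₃)
      (UTU m₁ m₂ m₃ t hD) (U_M31 m₁ m₂ m₃) (Q1 m₁ m₂ m₃ t hD)
    rwa [← M31_T, Matrix.transpose_transpose] at this
  · have := core _ _ _ _ (M42 m₁ m₂ m₃ t)ᵀ _ hT (U_mul_U m₁ m₂ m₃) (V_mul_V m₁ m₃)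
      (UTU m₁ m₂ m₃ t hD) (U_M32 m₁ m₂ m₃) (Q2 m₁ m₂ m₃ t hD)
    rwa [← M32_T, Matrix.transpose_transpose] at this


end TBT
end
end

section
/- For complex μ₁, μ₂ with μ₁,μ₂ ∉ {i/2, −i/2}, one has ℒ^*(A₁^* − μ₁I)^{−1}(A₂^* − μ₂I)^{−1} = q(μ) ℒ^*(A₁^* + μ₁I)^{−1}(A₂^* + μ₂I)^{−1}(U₁⊗U₂⊗I_{m₃}), where q(μ) = ((μ₁ − i/2)/(μ₁ + i/2))^{m₁}·((μ₂ − i/2)/(μ₂ + i/2))^{m₂}. -/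
open Matrix Kronecker BigOperators

noncomputable section

namespace TBT

/-- helper: row vector structure -/
def Rrow (m₁ m₂ m₃ : ℕ) (v : Fin m₁ → ℂ) (w : Fin m₂ → ℂ) :
    Matrix (Fin m₃) (Idx m₁ m₂ m₃) ℂ :=
  Matrix.of fun l x => v x.1.1 * w x.1.2 * (if x.2 = l then 1 else 0)

theorem Rrow_mul (m₁ m₂ m₃ : ℕ) (v : Fin m₁ → ℂ) (w : Fin m₂ → ℂ)
    (B : Matrix (Fin m₁) (Fin m₁) ℂ) (C : Matrix (Fin m₂) (Fin m₂) ℂ) :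
    Rrow m₁ m₂ m₃ v w * ((B ⊗ₖ C) ⊗ₖ (1 : Matrix (Fin m₃) (Fin m₃) ℂ)) =
      Rrow m₁ m₂ m₃ (v ᵥ* B) (w ᵥ* C) := by
  ext l x
  obtain ⟨⟨a, b⟩, c⟩ := x
  simp only [Rrow, Matrix.mul_apply, Matrix.of_apply, Fintype.sum_prod_type,
    Matrix.kroneckerMap_apply, Matrix.one_apply, Matrix.vecMul, dotProduct]
  rw [Finset.sum_mul_sum, Finset.sum_mul]
  refine Finset.sum_congr rfl fun i _ => ?_
  rw [Finset.sum_mul]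
  refine Finset.sum_congr rfl fun j _ => ?_
  rw [Finset.sum_eq_single c]
  · simp only [if_true]; ring
  · intro k _ hk; simp [hk]
  · simp

/-- helper: solution of the triangular system -/
def wv (n : ℕ) (mu : ℂ) : Fin n → ℂ := fun l =>
  -(mu + Complex.I / 2)⁻¹ * ((mu - Complex.I / 2) / (mu + Complex.I / 2)) ^ (l : ℕ)

theorem wB_apply (n : ℕ) (mu : ℂ) (j l : Fin n) :
    ((calA n)ᴴ - mu • 1) j l = (if (j : ℕ) < l then -Complex.I else 0) +
      (if (j : ℕ) = l then -(mu + Complex.I / 2) else 0) := by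
  simp only [calA, aEnt, Matrix.sub_apply, Matrix.conjTranspose_apply, Matrix.of_apply,
    Matrix.smul_apply, Matrix.one_apply, Fin.ext_iff]
  rcases lt_trichotomy (j : ℕ) (l : ℕ) with h | h | h
  · have h1 : ¬ ((l : ℕ) : ℤ) - ((j : ℕ) : ℤ) < 0 := by omega
    have h2 : ¬ ((l : ℕ) : ℤ) - ((j : ℕ) : ℤ) = 0 := by omega
    simp [h1, h2, h, h.ne]
  · simp [h]; ring
  · have h1 : ((l : ℕ) : ℤ) - ((j : ℕ) : ℤ) < 0 := by omega
    simp [h1, h.not_gt, h.ne']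

theorem wv_mul (n : ℕ) (mu : ℂ) (h : mu + Complex.I / 2 ≠ 0) :
    wv n mu ᵥ* ((calA n)ᴴ - mu • 1) = fun _ => 1 := by
  ext l
  simp only [Matrix.vecMul, dotProduct, wB_apply]
  set r := (mu - Complex.I / 2) / (mu + Complex.I / 2) with hr
  have key : ∀ k : ℕ, ∑ j ∈ Finset.range k,
      (-(mu + Complex.I / 2)⁻¹ * r ^ j) * (-Complex.I) = 1 - r ^ k := by
    intro k
    induction k with
    | zero => simp
    | succ k ih =>
      rw [Finset.sum_range_succ, ih, pow_succ]
      have : Complex.I * (mu + Complex.I / 2)⁻¹ = 1 - r := by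
        rw [hr, eq_sub_iff_add_eq, ← div_eq_mul_inv, ← add_div, div_eq_one_iff_eq h]; ring
      linear_combination r ^ k * this
  simp only [wv]
  rw [Fin.sum_univ_eq_sum_range (fun j : ℕ => (-(mu + Complex.I / 2)⁻¹ * r ^ j) *
    ((if j < (l : ℕ) then -Complex.I else 0) +
      (if j = (l : ℕ) then -(mu + Complex.I / 2) else 0))) n]
  rw [← Finset.sum_subset (Finset.range_subset_range.2 (Nat.succ_le_of_lt l.2)),
    Finset.sum_range_succ]
  · rw [Finset.sum_congr rfl (g := fun j => (-(mu + Complex.I / 2)⁻¹ * r ^ j) * (-Complex.I)),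
      key]
    · simp only [lt_irrefl, if_false, if_true, zero_add]
      have hc := inv_mul_cancel₀ h
      linear_combination r ^ (l : ℕ) * hc
    · intro j hj
      have := Finset.mem_range.1 hj
      simp [this, this.ne]
  · intro j _ hj
    have : ¬ j < (l : ℕ) + 1 := by simpa using hj
    have h1 : ¬ j < (l : ℕ) := by omega
    have h2 : ¬ j = (l : ℕ) := by omega
    simp [h1, h2]

theorem one_mul_inv (n : ℕ) (mu : ℂ) (h : mu + Complex.I / 2 ≠ 0) :
    (fun _ => 1) ᵥ* ((calA n)ᴴ - mu • 1)⁻¹ = wv n mu := by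
  have hd : IsUnit ((calA n)ᴴ - mu • 1).det := by
    rw [Matrix.det_of_isUpperTriangular]
    · simp only [wB_apply]
      simp only [lt_irrefl, if_false, if_true, zero_add]
      rw [isUnit_iff_ne_zero, Finset.prod_ne_zero_iff]
      intro i _
      exact neg_ne_zero.2 h
    · intro i j hij
      have : (j : ℕ) < i := hij
      rw [wB_apply]
      simp [this.not_gt, this.ne']
  rw [← wv_mul n mu h, Matrix.vecMul_vecMul, Matrix.mul_nonsing_inv _ hd, Matrix.vecMul_one]

theorem wv_rev (n : ℕ) (mu : ℂ) (h : mu + Complex.I / 2 ≠ 0) (h' : mu - Complex.I / 2 ≠ 0) :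
    ((mu - Complex.I / 2) / (mu + Complex.I / 2)) ^ n • (wv n (-mu) ᵥ* Up n) = - wv n mu := by
  ext l
  have hs : (wv n (-mu) ᵥ* Up n) l = wv n (-mu) (Fin.rev l) := by
    simp only [Matrix.vecMul, dotProduct, Up, Matrix.of_apply]
    rw [Finset.sum_eq_single (Fin.rev l)]
    · have : (Fin.rev l : ℕ) + l + 1 = n := by rw [Fin.val_rev]; omega
      rw [if_pos this, mul_one]
    · intro j _ hj
      have : ¬ (j : ℕ) + l + 1 = n := by
        intro hh; apply hj; ext; rw [Fin.val_rev]; omega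
      simp [this]
    · simp
  rw [Pi.smul_apply, hs]
  simp only [wv, Pi.neg_apply, smul_eq_mul]
  obtain ⟨k, hk⟩ : ∃ k, k = (Fin.rev l : ℕ) := ⟨_, rfl⟩
  have hn : n = k + l + 1 := by rw [hk, Fin.val_rev]; omega
  rw [← hk]
  have e : (-mu - Complex.I / 2) / (-mu + Complex.I / 2) =
      ((mu - Complex.I / 2) / (mu + Complex.I / 2))⁻¹ := by
    rw [inv_div, ← neg_div_neg_eq]; congr 1 <;> ring
  have e2 : -mu + Complex.I / 2 = -(mu - Complex.I / 2) := by ring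
  rw [e, e2]
  set r := (mu - Complex.I / 2) / (mu + Complex.I / 2) with hr
  have hr0 : r ≠ 0 := div_ne_zero h' h
  have e3 : r * (mu - Complex.I / 2)⁻¹ = (mu + Complex.I / 2)⁻¹ := by
    rw [hr, div_mul_eq_mul_div, mul_inv_cancel₀ h', one_div]
  have e4 : r ^ n = r ^ k * r ^ (l : ℕ) * r := by
    conv_lhs => rw [hn]
    rw [pow_succ, pow_add]
  rw [e4, inv_pow, inv_neg, neg_neg, neg_mul, neg_neg, ← e3]
  field_simp

theorem Lmat_eq (m₁ m₂ m₃ : ℕ) :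
    (Lmat m₁ m₂ m₃)ᴴ = Rrow m₁ m₂ m₃ (fun _ => 1) (fun _ => 1) := by
  ext l x
  simp only [Lmat, Rrow, Matrix.conjTranspose_apply, Matrix.of_apply]
  split_ifs <;> simp

theorem sub_kron {a b : Type*} (A B : Matrix a a ℂ) (C : Matrix b b ℂ) :
    (A - B) ⊗ₖ C = A ⊗ₖ C - B ⊗ₖ C := by
  ext x y
  simp only [Matrix.kroneckerMap_apply, Matrix.sub_apply, sub_mul]

theorem kron_sub {a b : Type*} (A : Matrix a a ℂ) (B C : Matrix b b ℂ) :
    A ⊗ₖ (B - C) = A ⊗ₖ B - A ⊗ₖ C := by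
  ext x y
  simp only [Matrix.kroneckerMap_apply, Matrix.sub_apply, mul_sub]

theorem A1_inv (m₁ m₂ m₃ : ℕ) (mu : ℂ) :
    ((A1 m₁ m₂ m₃)ᴴ - mu • 1)⁻¹ =
      (((calA m₁)ᴴ - mu • 1)⁻¹ ⊗ₖ (1 : Matrix (Fin m₂) (Fin m₂) ℂ)) ⊗ₖ
        (1 : Matrix (Fin m₃) (Fin m₃) ℂ) := by
  have : (A1 m₁ m₂ m₃)ᴴ - mu • 1 =
      (((calA m₁)ᴴ - mu • 1) ⊗ₖ (1 : Matrix (Fin m₂) (Fin m₂) ℂ)) ⊗ₖ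
        (1 : Matrix (Fin m₃) (Fin m₃) ℂ) := by
    rw [A1, Matrix.conjTranspose_kronecker, Matrix.conjTranspose_kronecker,
      Matrix.conjTranspose_one, Matrix.conjTranspose_one, sub_kron, sub_kron,
      Matrix.smul_kronecker, Matrix.smul_kronecker, Matrix.one_kronecker_one,
      Matrix.one_kronecker_one]
  rw [this, Matrix.inv_kronecker, Matrix.inv_kronecker, inv_one, inv_one]

theorem A2_inv (m₁ m₂ m₃ : ℕ) (mu : ℂ) :
    ((A2 m₁ m₂ m₃)ᴴ - mu • 1)⁻¹ =
      ((1 : Matrix (Fin m₁) (Fin m₁) ℂ) ⊗ₖ ((calA m₂)ᴴ - mu • 1)⁻¹) ⊗ₖ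
        (1 : Matrix (Fin m₃) (Fin m₃) ℂ) := by
  have : (A2 m₁ m₂ m₃)ᴴ - mu • 1 =
      ((1 : Matrix (Fin m₁) (Fin m₁) ℂ) ⊗ₖ ((calA m₂)ᴴ - mu • 1)) ⊗ₖ
        (1 : Matrix (Fin m₃) (Fin m₃) ℂ) := by
    rw [A2, Matrix.conjTranspose_kronecker, Matrix.conjTranspose_kronecker,
      Matrix.conjTranspose_one, Matrix.conjTranspose_one, kron_sub, sub_kron,
      Matrix.kronecker_smul, Matrix.smul_kronecker, Matrix.one_kronecker_one,
      Matrix.one_kronecker_one]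
  rw [this, Matrix.inv_kronecker, Matrix.inv_kronecker, inv_one, inv_one]

theorem L_prod (m₁ m₂ m₃ : ℕ) (mu₁ mu₂ : ℂ) (h₁ : mu₁ + Complex.I / 2 ≠ 0)
    (h₂ : mu₂ + Complex.I / 2 ≠ 0) :
    (Lmat m₁ m₂ m₃)ᴴ * ((A1 m₁ m₂ m₃)ᴴ - mu₁ • 1)⁻¹ * ((A2 m₁ m₂ m₃)ᴴ - mu₂ • 1)⁻¹ =
      Rrow m₁ m₂ m₃ (wv m₁ mu₁) (wv m₂ mu₂) := by
  rw [Lmat_eq, A1_inv, A2_inv, Rrow_mul, Rrow_mul, Matrix.vecMul_one, Matrix.vecMul_one,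
    one_mul_inv _ _ h₁, one_mul_inv _ _ h₂]

/-- `ℒ^*(A₁^*-μ₁I)⁻¹(A₂^*-μ₂I)⁻¹ =
q(μ) ℒ^*(A₁^*+μ₁I)⁻¹(A₂^*+μ₂I)⁻¹ (U₁⊗U₂⊗I_{m₃})`. -/
theorem statement17 (m₁ m₂ m₃ : ℕ) (hm₁ : 2 ≤ m₁) (hm₂ : 2 ≤ m₂) (hm₃ : 2 ≤ m₃)
    (mu₁ mu₂ : ℂ)
    (hmu₁ : mu₁ ≠ Complex.I / 2) (hmu₁' : mu₁ ≠ -(Complex.I / 2))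
    (hmu₂ : mu₂ ≠ Complex.I / 2) (hmu₂' : mu₂ ≠ -(Complex.I / 2)) :
    (Lmat m₁ m₂ m₃)ᴴ * ((A1 m₁ m₂ m₃)ᴴ - mu₁ • 1)⁻¹ * ((A2 m₁ m₂ m₃)ᴴ - mu₂ • 1)⁻¹ =
      qfun m₁ m₂ mu₁ mu₂ •
        ((Lmat m₁ m₂ m₃)ᴴ * ((A1 m₁ m₂ m₃)ᴴ + mu₁ • 1)⁻¹ * ((A2 m₁ m₂ m₃)ᴴ + mu₂ • 1)⁻¹ *
          ((Up m₁ ⊗ₖ Up m₂) ⊗ₖ (1 : Matrix (Fin m₃) (Fin m₃) ℂ))) := by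
  have a₁ : mu₁ + Complex.I / 2 ≠ 0 := fun h => hmu₁' (eq_neg_of_add_eq_zero_left h)
  have a₂ : mu₂ + Complex.I / 2 ≠ 0 := fun h => hmu₂' (eq_neg_of_add_eq_zero_left h)
  have b₁ : mu₁ - Complex.I / 2 ≠ 0 := sub_ne_zero.2 hmu₁
  have b₂ : mu₂ - Complex.I / 2 ≠ 0 := sub_ne_zero.2 hmu₂
  have c₁ : -mu₁ + Complex.I / 2 ≠ 0 := by
    intro h; apply b₁; linear_combination -h
  have c₂ : -mu₂ + Complex.I / 2 ≠ 0 := by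
    intro h; apply b₂; linear_combination -h
  have e := L_prod m₁ m₂ m₃ (-mu₁) (-mu₂) c₁ c₂
  simp only [neg_smul, sub_neg_eq_add] at e
  rw [L_prod _ _ _ _ _ a₁ a₂, e, Rrow_mul]
  have r₁ := wv_rev m₁ mu₁ a₁ b₁
  have r₂ := wv_rev m₂ mu₂ a₂ b₂
  ext l x
  have s₁ := congrFun r₁ x.1.1
  have s₂ := congrFun r₂ x.1.2
  simp only [Pi.smul_apply, Pi.neg_apply, smul_eq_mul] at s₁ s₂
  simp only [Rrow, qfun, Matrix.smul_apply, Matrix.of_apply, smul_eq_mul]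
  rw [eq_neg_iff_add_eq_zero, add_comm, ← eq_neg_iff_add_eq_zero] at s₁ s₂
  rw [s₁, s₂]
  ring

end TBT
end
end

section
/- (Theorem 4.1, first part) Let T be an invertible block TBT-matrix belonging to the DSTU class and let μ = (μ₁,μ₂) with μ₁,μ₂ ∉ {i/2, −i/2}. Then for {k,p} = {1,2} with k ≠ p: u_p(μ) = −q(μ) U₃ û_p(μ)^τ Ũ_k, where q(μ) = ((μ₁ − i/2)/(μ₁ + i/2))^{m₁}·((μ₂ − i/2)/(μ₂ + i/2))^{m₂} and Ũ_k = [[0, −U_k⊗U₃],[U_k⊗U₃, 0]]. -/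
open Matrix Kronecker BigOperators

noncomputable section

namespace TBT

def cc (n : ℕ) (z : ℂ) : ℂ := ((z - Complex.I / 2) / (z + Complex.I / 2)) ^ n
def rr (n : ℕ) (z : ℂ) : Fin n → ℂ :=
  Matrix.vecMul (fun _ : Fin n => (1 : ℂ)) (((calA n)ᴴ - z • 1)⁻¹)
def ss (n : ℕ) (z : ℂ) : Fin n → ℂ :=
  Matrix.mulVec ((calA n - z • 1)⁻¹) (fun _ : Fin n => (1 : ℂ))

lemma det_calA (n : ℕ) (z : ℂ) : (calA n - z • 1).det = (Complex.I / 2 - z) ^ n := by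
  rw [Matrix.det_of_lowerTriangular]
  · simp [calA, aEnt]
  · intro i j hij
    have hij' : i < j := hij
    have h1 : i ≠ j := ne_of_lt hij'
    have h2 : ((i : ℕ) : ℤ) - ((j : ℕ) : ℤ) < 0 := by
      have : (i : ℕ) < j := hij'
      omega
    simp only [calA, aEnt, Matrix.sub_apply, Matrix.of_apply, Matrix.smul_apply,
      Matrix.one_apply_ne h1, if_pos h2]
    simp

lemma calAH (n : ℕ) : (calA n)ᴴ = -(calA n)ᵀ := by
  ext i j
  simp only [calA, aEnt, Matrix.conjTranspose_apply, Matrix.of_apply, Matrix.neg_apply,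
    Matrix.transpose_apply]
  split_ifs <;> simp [neg_div]

lemma det_calAH (n : ℕ) (z : ℂ) :
    ((calA n)ᴴ - z • 1).det = (-(Complex.I / 2) - z) ^ n := by
  have : (calA n)ᴴ - z • 1 = -(calA n - (-z) • 1)ᵀ := by
    rw [calAH]; simp; abel
  rw [this, Matrix.det_neg, Matrix.det_transpose, det_calA, Fintype.card_fin, ← mul_pow]
  ring

lemma calA_eq (n : ℕ) :
    calA n = (calA n)ᴴ + Matrix.replicateCol Unit (fun _ : Fin n => Complex.I) *
      Matrix.replicateRow Unit (fun _ : Fin n => (1 : ℂ)) := by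
  rw [calAH]
  ext i j
  simp only [calA, aEnt, Matrix.of_apply, Matrix.neg_apply, Matrix.add_apply,
    Matrix.transpose_apply, Matrix.mul_apply, Matrix.replicateCol_apply,
    Matrix.replicateRow_apply, Finset.univ_unique, Finset.sum_singleton]
  split_ifs <;> first | omega | ring

lemma unit_calA (n : ℕ) (z : ℂ) (h : z ≠ Complex.I / 2) : IsUnit (calA n - z • 1).det := by
  rw [det_calA]; exact (IsUnit.mk0 _ (sub_ne_zero.2 h.symm)).pow n

lemma unit_calAH (n : ℕ) (z : ℂ) (h : z ≠ -(Complex.I / 2)) :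
    IsUnit ((calA n)ᴴ - z • 1).det := by
  rw [det_calAH]; exact (IsUnit.mk0 _ (sub_ne_zero.2 h.symm)).pow n

lemma cc_eq (n : ℕ) (z : ℂ) (h' : z ≠ -(Complex.I / 2)) :
    cc n z = 1 + Complex.I * ∑ i, rr n z i := by
  have hu := unit_calAH n z h'
  have h1 := Matrix.det_add_replicateCol_mul_replicateRow (ι := Unit) hu
    (fun _ : Fin n => Complex.I) (fun _ : Fin n => (1 : ℂ))
  have h2 : (calA n)ᴴ - z • 1 + Matrix.replicateCol Unit (fun _ : Fin n => Complex.I) *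
      Matrix.replicateRow Unit (fun _ : Fin n => (1 : ℂ)) = calA n - z • 1 := by
    conv_rhs => rw [calA_eq n]
    abel
  rw [h2, det_calA, det_calAH, Matrix.det_unique] at h1
  have h3 : ((1 : Matrix Unit Unit ℂ) + Matrix.replicateRow Unit (fun _ : Fin n => (1 : ℂ)) *
      ((calA n)ᴴ - z • 1)⁻¹ *
      Matrix.replicateCol Unit (fun _ : Fin n => Complex.I) : Matrix Unit Unit ℂ) default default =
      1 + Complex.I * ∑ i, rr n z i := by
    rw [Matrix.add_apply, Matrix.one_apply_eq, Matrix.mul_apply, Finset.mul_sum]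
    congr 1
    refine Finset.sum_congr rfl fun i _ => ?_
    simp [rr, Matrix.mul_apply, Matrix.vecMul, dotProduct, mul_comm]
  rw [h3] at h1
  have hz : z + Complex.I / 2 ≠ 0 := fun h => h' (eq_neg_of_add_eq_zero_left h)
  have h4 : (-1 : ℂ) ^ n * (-1) ^ n = 1 := by rw [← mul_pow]; simp
  have e1 : (Complex.I / 2 - z) ^ n = (-1) ^ n * (z - Complex.I / 2) ^ n := by
    rw [← mul_pow]; ring
  have e2 : (-(Complex.I / 2) - z) ^ n = (-1) ^ n * (z + Complex.I / 2) ^ n := by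
    rw [← mul_pow]; ring
  rw [e1, e2, mul_assoc] at h1
  have h5 := mul_left_cancel₀ (pow_ne_zero n (by norm_num : (-1 : ℂ) ≠ 0)) h1
  rw [cc, div_pow, h5]
  exact mul_div_cancel_left₀ _ (pow_ne_zero n hz)

lemma rr_eq (n : ℕ) (z : ℂ) (h : z ≠ Complex.I / 2) (h' : z ≠ -(Complex.I / 2)) (i : Fin n) :
    rr n z i = cc n z * ss n z (Fin.rev i) := by
  have e1 : rr n z ᵥ* (calA n - z • 1) = fun _ => cc n z := by
    have h2 : calA n - z • 1 = ((calA n)ᴴ - z • 1) +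
        Matrix.replicateCol Unit (fun _ : Fin n => Complex.I) *
        Matrix.replicateRow Unit (fun _ : Fin n => (1 : ℂ)) := by
      conv_lhs => rw [calA_eq n]
      abel
    rw [h2, Matrix.vecMul_add]
    have h3 : rr n z ᵥ* ((calA n)ᴴ - z • 1) = fun _ => 1 := by
      rw [rr, Matrix.vecMul_vecMul, Matrix.nonsing_inv_mul _ (unit_calAH n z h'),
        Matrix.vecMul_one]
    rw [h3]
    funext j
    rw [cc_eq n z h', Pi.add_apply]
    simp [Matrix.vecMul, dotProduct, Matrix.mul_apply, Finset.mul_sum, mul_comm]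
  have e3 : (calA n - z • 1) *ᵥ ss n z = fun _ => 1 := by
    rw [ss, Matrix.mulVec_mulVec, Matrix.mul_nonsing_inv _ (unit_calA n z h), Matrix.one_mulVec]
  have e2 : (fun i => cc n z * ss n z (Fin.rev i)) ᵥ* (calA n - z • 1) = fun _ => cc n z := by
    funext j
    have := congrFun e3 (Fin.rev j)
    simp only [Matrix.mulVec, dotProduct] at this
    simp only [Matrix.vecMul, dotProduct]
    refine Eq.trans ?_ (mul_one (cc n z))
    rw [← this, Finset.mul_sum, ← Equiv.sum_comp Fin.revPerm]
    refine Finset.sum_congr rfl fun i _ => ?_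
    have e : (calA n - z • 1) (Fin.rev i) j = (calA n - z • 1) (Fin.rev j) i := by
      simp only [calA, Matrix.sub_apply, Matrix.of_apply, Matrix.smul_apply, Matrix.one_apply]
      have a1 : (((Fin.rev i : Fin n) : ℕ) : ℤ) - (j : ℕ) =
          (((Fin.rev j : Fin n) : ℕ) : ℤ) - (i : ℕ) := by
        rw [Fin.val_rev, Fin.val_rev]; omega
      have a2 : (Fin.rev i = j) ↔ (Fin.rev j = i) := by
        constructor <;> (rintro rfl; simp)
      rw [a1]
      simp only [a2]
    simp only [Fin.revPerm_apply, Fin.rev_rev, e]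
    ring
  have e4 : rr n z = fun i => cc n z * ss n z (Fin.rev i) := by
    have := congrArg (fun v => v ᵥ* (calA n - z • 1)⁻¹) (e1.trans e2.symm)
    simpa only [Matrix.vecMul_vecMul, Matrix.mul_nonsing_inv _ (unit_calA n z h),
      Matrix.vecMul_one] using this
  exact congrFun e4 i

lemma cc_ss (n : ℕ) (z : ℂ) (h : z ≠ Complex.I / 2) (h' : z ≠ -(Complex.I / 2)) :
    cc n z * (∑ i, ss n z i + Complex.I) = Complex.I := by
  have h1 := cc_eq n z h'
  have h2 : ∑ i, rr n z i = cc n z * ∑ i, ss n z i := by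
    rw [Finset.mul_sum, ← Equiv.sum_comp Fin.revPerm]
    refine Finset.sum_congr rfl fun i _ => ?_
    rw [rr_eq n z h h']; simp
  rw [h2] at h1
  linear_combination Complex.I * h1 + (cc n z * ∑ i, ss n z i) * Complex.I_mul_I

lemma Up_apply {n : ℕ} (i j : Fin n) : Up n i j = if j = Fin.rev i then 1 else 0 := by
  have : ((i : ℕ) + (j : ℕ) + 1 = n) ↔ j = Fin.rev i := by
    rw [Fin.ext_iff, Fin.val_rev]; omega
  simp only [Up, Matrix.of_apply, this]

lemma Up_apply' {n : ℕ} (i j : Fin n) : Up n i j = if i = Fin.rev j then 1 else 0 := by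
  have : ((i : ℕ) + (j : ℕ) + 1 = n) ↔ i = Fin.rev j := by
    rw [Fin.ext_iff, Fin.val_rev]; omega
  simp only [Up, Matrix.of_apply, this]

lemma Up_mul {n : ℕ} {β : Type*} (M : Matrix (Fin n) β ℂ) (i : Fin n) (j : β) :
    (Up n * M) i j = M (Fin.rev i) j := by
  simp [Matrix.mul_apply, Up_apply]

lemma mul_Up {n : ℕ} {β : Type*} (M : Matrix β (Fin n) ℂ) (i : β) (j : Fin n) :
    (M * Up n) i j = M i (Fin.rev j) := by
  simp [Matrix.mul_apply, Up_apply']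

lemma mul_V_s18 {n m : ℕ} {β : Type*} (M : Matrix β (Fin n × Fin m) ℂ) (i : β) (j : Fin n × Fin m) :
    (M * (Up n ⊗ₖ Up m)) i j = M i (Fin.rev j.1, Fin.rev j.2) := by
  simp [Matrix.mul_apply, Up_apply', Matrix.kroneckerMap_apply, Fintype.sum_prod_type]

def rx {m₁ m₂ m₃ : ℕ} (x : Idx m₁ m₂ m₃) : Idx m₁ m₂ m₃ :=
  ((Fin.rev x.1.1, Fin.rev x.1.2), Fin.rev x.2)

lemma Umat_mul {m₁ m₂ m₃ : ℕ} {β : Type*} (M : Matrix (Idx m₁ m₂ m₃) β ℂ)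
    (i : Idx m₁ m₂ m₃) (j : β) : (Umat m₁ m₂ m₃ * M) i j = M (rx i) j := by
  simp [Umat, Matrix.mul_apply, Up_apply, Matrix.kroneckerMap_apply, Fintype.sum_prod_type, rx]

lemma mul_Umat {m₁ m₂ m₃ : ℕ} {β : Type*} (M : Matrix β (Idx m₁ m₂ m₃) ℂ)
    (i : β) (j : Idx m₁ m₂ m₃) : (M * Umat m₁ m₂ m₃) i j = M i (rx j) := by
  simp [Umat, Matrix.mul_apply, Up_apply', Matrix.kroneckerMap_apply, Fintype.sum_prod_type, rx]

lemma dstu_apply {m₃ : ℕ} {t : ℤ → ℤ → Matrix (Fin m₃) (Fin m₃) ℂ} (hD : DSTU m₃ t)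
    (r j : ℤ) (a b : Fin m₃) : t r j (Fin.rev a) (Fin.rev b) = t r j b a := by
  have := congrFun (congrFun (hD r j) a) b
  rw [mul_Up, Up_mul, Matrix.transpose_apply] at this
  exact this

lemma dstu_apply' {m₃ : ℕ} {t : ℤ → ℤ → Matrix (Fin m₃) (Fin m₃) ℂ} (hD : DSTU m₃ t)
    (r j : ℤ) (a b : Fin m₃) : t r j (Fin.rev a) b = t r j (Fin.rev b) a := by
  have := dstu_apply hD r j a (Fin.rev b)
  rwa [Fin.rev_rev] at this

lemma UT (m₁ m₂ m₃ : ℕ) (t : ℤ → ℤ → Matrix (Fin m₃) (Fin m₃) ℂ) (hD : DSTU m₃ t) :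
    Umat m₁ m₂ m₃ * Tmat m₁ m₂ m₃ t = (Tmat m₁ m₂ m₃ t)ᵀ * Umat m₁ m₂ m₃ := by
  ext x y
  rw [Umat_mul, mul_Umat, Matrix.transpose_apply]
  simp only [Tmat, Matrix.of_apply, rx]
  rw [dstu_apply' hD]
  have e1 : (((Fin.rev x.1.1 : Fin m₁) : ℕ) : ℤ) - ((y.1.1 : ℕ) : ℤ) =
      (((Fin.rev y.1.1 : Fin m₁) : ℕ) : ℤ) - ((x.1.1 : ℕ) : ℤ) := by
    rw [Fin.val_rev, Fin.val_rev]; omega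
  have e2 : (((Fin.rev x.1.2 : Fin m₂) : ℕ) : ℤ) - ((y.1.2 : ℕ) : ℤ) =
      (((Fin.rev y.1.2 : Fin m₂) : ℕ) : ℤ) - ((x.1.2 : ℕ) : ℤ) := by
    rw [Fin.val_rev, Fin.val_rev]; omega
  rw [e1, e2]

lemma UR (m₁ m₂ m₃ : ℕ) (t : ℤ → ℤ → Matrix (Fin m₃) (Fin m₃) ℂ) (hD : DSTU m₃ t)
    (hT : IsUnit (Tmat m₁ m₂ m₃ t)) :
    Umat m₁ m₂ m₃ * (Tmat m₁ m₂ m₃ t)⁻¹ = ((Tmat m₁ m₂ m₃ t)⁻¹)ᵀ * Umat m₁ m₂ m₃ := by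
  have hd := (Matrix.isUnit_iff_isUnit_det _).1 hT
  have h := congrArg (fun X => ((Tmat m₁ m₂ m₃ t)⁻¹)ᵀ * X * (Tmat m₁ m₂ m₃ t)⁻¹)
    (UT m₁ m₂ m₃ t hD)
  rw [← Matrix.mul_assoc, Matrix.mul_assoc _ _ (Tmat m₁ m₂ m₃ t)⁻¹,
    Matrix.mul_nonsing_inv _ hd, Matrix.mul_one, ← Matrix.mul_assoc, ← Matrix.transpose_mul,
    Matrix.mul_nonsing_inv _ hd, Matrix.transpose_one, Matrix.one_mul] at h
  exact h.symm

def Sm (m₁ m₂ m₃ : ℕ) (z₁ z₂ : ℂ) : Matrix (Idx m₁ m₂ m₃) (Fin m₃) ℂ :=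
  (A1 m₁ m₂ m₃ - z₁ • 1)⁻¹ * (A2 m₁ m₂ m₃ - z₂ • 1)⁻¹ * Lmat m₁ m₂ m₃

def Wm (m₁ m₂ m₃ : ℕ) (z₁ z₂ : ℂ) : Matrix (Fin m₃) (Idx m₁ m₂ m₃) ℂ :=
  (Lmat m₁ m₂ m₃)ᴴ * ((A1 m₁ m₂ m₃)ᴴ - z₁ • 1)⁻¹ * ((A2 m₁ m₂ m₃)ᴴ - z₂ • 1)⁻¹

lemma kron1 {m₁ m₂ m₃ : ℕ} (X : Matrix (Fin m₁) (Fin m₁) ℂ) (z : ℂ) :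
    (X ⊗ₖ (1 : Matrix (Fin m₂) (Fin m₂) ℂ)) ⊗ₖ (1 : Matrix (Fin m₃) (Fin m₃) ℂ) - z • 1 =
    ((X - z • 1) ⊗ₖ (1 : Matrix (Fin m₂) (Fin m₂) ℂ)) ⊗ₖ (1 : Matrix (Fin m₃) (Fin m₃) ℂ) := by
  ext ⟨⟨a, b⟩, c⟩ ⟨⟨a', b'⟩, c'⟩
  simp only [Matrix.sub_apply, Matrix.smul_apply, Matrix.kroneckerMap_apply, Matrix.one_apply,
    Prod.mk.injEq, smul_eq_mul]
  by_cases h1 : a = a' <;> by_cases h2 : b = b' <;> by_cases h3 : c = c' <;> simp [h1, h2, h3]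

lemma kron2 {m₁ m₂ m₃ : ℕ} (X : Matrix (Fin m₂) (Fin m₂) ℂ) (z : ℂ) :
    ((1 : Matrix (Fin m₁) (Fin m₁) ℂ) ⊗ₖ X) ⊗ₖ (1 : Matrix (Fin m₃) (Fin m₃) ℂ) - z • 1 =
    ((1 : Matrix (Fin m₁) (Fin m₁) ℂ) ⊗ₖ (X - z • 1)) ⊗ₖ (1 : Matrix (Fin m₃) (Fin m₃) ℂ) := by
  ext ⟨⟨a, b⟩, c⟩ ⟨⟨a', b'⟩, c'⟩
  simp only [Matrix.sub_apply, Matrix.smul_apply, Matrix.kroneckerMap_apply, Matrix.one_apply,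
    Prod.mk.injEq, smul_eq_mul]
  by_cases h1 : a = a' <;> by_cases h2 : b = b' <;> by_cases h3 : c = c' <;> simp [h1, h2, h3]

lemma Sm_apply (m₁ m₂ m₃ : ℕ) (z₁ z₂ : ℂ) (x : Idx m₁ m₂ m₃) (l : Fin m₃) :
    Sm m₁ m₂ m₃ z₁ z₂ x l = ss m₁ z₁ x.1.1 * ss m₂ z₂ x.1.2 * if x.2 = l then 1 else 0 := by
  rw [Sm, A1, A2, kron1, kron2]
  simp only [Matrix.inv_kronecker, inv_one, ← Matrix.mul_kronecker_mul, Matrix.one_mul,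
    Matrix.mul_one]
  simp [Matrix.mul_apply, Matrix.kroneckerMap_apply, Fintype.sum_prod_type, Lmat, ss,
    Matrix.mulVec, dotProduct, Matrix.one_apply, Finset.sum_mul_sum]

lemma Wm_apply (m₁ m₂ m₃ : ℕ) (z₁ z₂ : ℂ) (x : Idx m₁ m₂ m₃) (l : Fin m₃) :
    Wm m₁ m₂ m₃ z₁ z₂ l x = rr m₁ z₁ x.1.1 * rr m₂ z₂ x.1.2 * if x.2 = l then 1 else 0 := by
  rw [Wm, A1, A2]
  simp only [Matrix.conjTranspose_kronecker, Matrix.conjTranspose_one]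
  rw [kron1, kron2, Matrix.mul_assoc]
  simp only [Matrix.inv_kronecker, inv_one, ← Matrix.mul_kronecker_mul, Matrix.one_mul,
    Matrix.mul_one]
  simp only [Matrix.mul_apply, Matrix.kroneckerMap_apply, Fintype.sum_prod_type, Lmat, rr,
    Matrix.vecMul, dotProduct, Matrix.one_apply, Finset.sum_mul_sum,
    Matrix.conjTranspose_apply, Matrix.of_apply, one_mul]
  rw [Finset.sum_mul]
  refine Finset.sum_congr rfl fun i _ => ?_
  rw [Finset.sum_mul]
  refine Finset.sum_congr rfl fun j _ => ?_
  by_cases h : x.2 = l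
  · simp [apply_ite, h]
  · simp [apply_ite, h, Ne.symm h]

lemma Wm_eq (m₁ m₂ m₃ : ℕ) (z₁ z₂ : ℂ)
    (h₁ : z₁ ≠ Complex.I / 2) (h₁' : z₁ ≠ -(Complex.I / 2))
    (h₂ : z₂ ≠ Complex.I / 2) (h₂' : z₂ ≠ -(Complex.I / 2)) :
    Wm m₁ m₂ m₃ z₁ z₂ =
      (qfun m₁ m₂ z₁ z₂) • (Up m₃ * (Sm m₁ m₂ m₃ z₁ z₂)ᵀ * Umat m₁ m₂ m₃) := by
  ext l x
  rw [Wm_apply, Matrix.smul_apply, mul_Umat, Up_mul, Matrix.transpose_apply, Sm_apply,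
    rr_eq _ _ h₁ h₁', rr_eq _ _ h₂ h₂']
  have hq : qfun m₁ m₂ z₁ z₂ = cc m₁ z₁ * cc m₂ z₂ := rfl
  rw [hq]
  by_cases h : x.2 = l
  · simp [rx, h]; ring
  · simp [rx, h]

lemma sum_lem (n : ℕ) (f : ℤ → ℂ) (i : Fin n) :
    (2⁻¹ * f 0 + ∑ s ∈ Finset.range ((Fin.rev i : Fin n) : ℕ), f ((s : ℤ) + 1)) +
    (2⁻¹ * f 0 + ∑ s ∈ Finset.range (i : ℕ), f (-((s : ℤ) + 1))) =
    ∑ j : Fin n, f (((j : ℕ) : ℤ) - ((i : ℕ) : ℤ)) := by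
  rw [Fin.sum_univ_eq_sum_range (fun j => f ((j : ℤ) - ((i : ℕ) : ℤ))) n]
  have hn : n = (i : ℕ) + (((Fin.rev i : Fin n) : ℕ) + 1) := by rw [Fin.val_rev]; omega
  generalize ((Fin.rev i : Fin n) : ℕ) = k at *
  generalize (i : ℕ) = a at *
  subst hn
  rw [Finset.sum_range_add, Finset.sum_range_succ',
    ← Finset.sum_range_reflect (fun x => f ((x : ℤ) - (a : ℤ)))]
  have e1 : ∑ j ∈ Finset.range a, f (((a - 1 - j : ℕ) : ℤ) - (a : ℤ)) =
      ∑ s ∈ Finset.range a, f (-((s : ℤ) + 1)) := by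
    refine Finset.sum_congr rfl fun s hs => ?_
    have := Finset.mem_range.1 hs
    congr 1; omega
  have e2 : ∑ s ∈ Finset.range k, f (((a + (s + 1) : ℕ) : ℤ) - (a : ℤ)) =
      ∑ s ∈ Finset.range k, f ((s : ℤ) + 1) := by
    refine Finset.sum_congr rfl fun s hs => ?_
    congr 1; push_cast; ring
  rw [e1, e2]
  simp
  ring

lemma Pi1_eq (m₁ m₂ m₃ : ℕ) (t : ℤ → ℤ → Matrix (Fin m₃) (Fin m₃) ℂ) (hD : DSTU m₃ t) :
    Umat m₁ m₂ m₃ * Pi1 m₁ m₂ m₃ t + (Pihat1 m₁ m₂ m₃ t)ᵀ * Utilde m₂ m₃ =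
    Matrix.fromCols ((Tmat m₁ m₂ m₃ t)ᵀ * ((M21 m₁ m₂ m₃)ᵀ * (Up m₂ ⊗ₖ Up m₃))) 0 := by
  rw [Pi1, Pihat1, Utilde, Matrix.transpose_fromRows, Matrix.fromCols_mul_fromBlocks,
    Matrix.mul_fromCols]
  ext x (y | y)
  · simp only [Matrix.add_apply, Matrix.fromCols_apply_inl, Matrix.mul_zero, zero_add]
    rw [Umat_mul, mul_V_s18, ← Matrix.mul_assoc, mul_V_s18, Matrix.transpose_apply, Matrix.mul_apply]
    simp only [M11, M41, M21, calT, Tmat, Matrix.of_apply, Matrix.add_apply, Matrix.smul_apply,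
      Matrix.sum_apply, Matrix.transpose_apply, rx, Fintype.sum_prod_type, smul_eq_mul]
    have e : ((Fin.rev x.1.2 : Fin m₂) : ℕ) - (y.1 : ℕ) =
        (((Fin.rev y.1 : Fin m₂) : ℕ) : ℤ) - ((x.1.2 : ℕ) : ℤ) := by
      rw [Fin.val_rev, Fin.val_rev]; omega
    simp only [e, dstu_apply' hD _ _ x.2]
    rw [sum_lem m₁ (fun r => t r ((((Fin.rev y.1 : Fin m₂) : ℕ) : ℤ) - ((x.1.2 : ℕ) : ℤ))
      (Fin.rev y.2) x.2)]
    simp [ite_and]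
  · simp only [Matrix.add_apply, Matrix.fromCols_apply_inr, Matrix.mul_zero, add_zero,
      Matrix.mul_neg, Matrix.neg_apply, Matrix.zero_apply]
    rw [Umat_mul, mul_V_s18]
    simp only [M31, M21, rx, Matrix.conjTranspose_apply, Matrix.transpose_apply, Matrix.of_apply]
    have e1 : (y.1 = Fin.rev x.1.2) ↔ (Fin.rev y.1 = x.1.2) := Fin.rev_eq_iff.symm
    have e2 : (y.2 = Fin.rev x.2) ↔ (Fin.rev y.2 = x.2) := Fin.rev_eq_iff.symm
    by_cases h1 : Fin.rev y.1 = x.1.2 <;> by_cases h2 : Fin.rev y.2 = x.2 <;>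
      simp [e1, e2, h1, h2]

lemma Pi2_eq (m₁ m₂ m₃ : ℕ) (t : ℤ → ℤ → Matrix (Fin m₃) (Fin m₃) ℂ) (hD : DSTU m₃ t) :
    Umat m₁ m₂ m₃ * Pi2 m₁ m₂ m₃ t + (Pihat2 m₁ m₂ m₃ t)ᵀ * Utilde m₁ m₃ =
    Matrix.fromCols ((Tmat m₁ m₂ m₃ t)ᵀ * ((M22 m₁ m₂ m₃)ᵀ * (Up m₁ ⊗ₖ Up m₃))) 0 := by
  rw [Pi2, Pihat2, Utilde, Matrix.transpose_fromRows, Matrix.fromCols_mul_fromBlocks,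
    Matrix.mul_fromCols]
  ext x (y | y)
  · simp only [Matrix.add_apply, Matrix.fromCols_apply_inl, Matrix.mul_zero, zero_add]
    rw [Umat_mul, mul_V_s18, ← Matrix.mul_assoc, mul_V_s18, Matrix.transpose_apply, Matrix.mul_apply]
    simp only [M12, M42, M22, M12blk, M42blk, Tmat, Matrix.of_apply, Matrix.add_apply,
      Matrix.smul_apply,
      Matrix.sum_apply, Matrix.transpose_apply, rx, Fintype.sum_prod_type, smul_eq_mul]
    have e : ((Fin.rev x.1.1 : Fin m₁) : ℕ) - (y.1 : ℕ) =
        (((Fin.rev y.1 : Fin m₁) : ℕ) : ℤ) - ((x.1.1 : ℕ) : ℤ) := by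
      rw [Fin.val_rev, Fin.val_rev]; omega
    simp only [e, dstu_apply' hD _ _ x.2]
    rw [sum_lem m₂ (fun r => t ((((Fin.rev y.1 : Fin m₁) : ℕ) : ℤ) - ((x.1.1 : ℕ) : ℤ)) r
      (Fin.rev y.2) x.2)]
    simp [ite_and]
  · simp only [Matrix.add_apply, Matrix.fromCols_apply_inr, Matrix.mul_zero, add_zero,
      Matrix.mul_neg, Matrix.neg_apply, Matrix.zero_apply]
    rw [Umat_mul, mul_V_s18]
    simp only [M32, M22, rx, Matrix.conjTranspose_apply, Matrix.transpose_apply, Matrix.of_apply]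
    have e1 : (y.1 = Fin.rev x.1.1) ↔ (Fin.rev y.1 = x.1.1) := Fin.rev_eq_iff.symm
    have e2 : (y.2 = Fin.rev x.2) ↔ (Fin.rev y.2 = x.2) := Fin.rev_eq_iff.symm
    by_cases h1 : Fin.rev y.1 = x.1.1 <;> by_cases h2 : Fin.rev y.2 = x.2 <;>
      simp [e1, e2, h1, h2]

lemma core_s18 {m₁ m₂ m₃ : ℕ} {β : Type*} [Fintype β]
    (t : ℤ → ℤ → Matrix (Fin m₃) (Fin m₃) ℂ) (hD : DSTU m₃ t)
    (hT : IsUnit (Tmat m₁ m₂ m₃ t)) (z₁ z₂ : ℂ)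
    (h₁ : z₁ ≠ Complex.I / 2) (h₁' : z₁ ≠ -(Complex.I / 2))
    (h₂ : z₂ ≠ Complex.I / 2) (h₂' : z₂ ≠ -(Complex.I / 2))
    (P : Matrix (Idx m₁ m₂ m₃) (β ⊕ β) ℂ) (Ph : Matrix (β ⊕ β) (Idx m₁ m₂ m₃) ℂ)
    (V : Matrix (β ⊕ β) (β ⊕ β) ℂ) (Y : Matrix (Idx m₁ m₂ m₃) β ℂ)
    (hP : Umat m₁ m₂ m₃ * P + Phᵀ * V = Matrix.fromCols ((Tmat m₁ m₂ m₃ t)ᵀ * Y) 0) :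
    Wm m₁ m₂ m₃ z₁ z₂ * ((Tmat m₁ m₂ m₃ t)⁻¹ * P) +
      qfun m₁ m₂ z₁ z₂ • (Up m₃ * (Ph * (Tmat m₁ m₂ m₃ t)⁻¹ * Sm m₁ m₂ m₃ z₁ z₂)ᵀ * V) =
    qfun m₁ m₂ z₁ z₂ • Matrix.fromCols (Up m₃ * (Sm m₁ m₂ m₃ z₁ z₂)ᵀ * Y) 0 := by
  have hd := (Matrix.isUnit_iff_isUnit_det _).1 hT
  rw [Wm_eq _ _ _ _ _ h₁ h₁' h₂ h₂', Matrix.smul_mul, ← smul_add]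
  congr 1
  have e1 : Up m₃ * (Sm m₁ m₂ m₃ z₁ z₂)ᵀ * Umat m₁ m₂ m₃ * ((Tmat m₁ m₂ m₃ t)⁻¹ * P) =
      Up m₃ * (Sm m₁ m₂ m₃ z₁ z₂)ᵀ * ((Tmat m₁ m₂ m₃ t)⁻¹)ᵀ * (Umat m₁ m₂ m₃ * P) := by
    rw [Matrix.mul_assoc _ (Umat _ _ _), ← Matrix.mul_assoc (Umat _ _ _) _ P, UR _ _ _ _ hD hT]
    simp only [Matrix.mul_assoc]
  have e2 : Up m₃ * (Ph * (Tmat m₁ m₂ m₃ t)⁻¹ * Sm m₁ m₂ m₃ z₁ z₂)ᵀ * V =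
      Up m₃ * (Sm m₁ m₂ m₃ z₁ z₂)ᵀ * ((Tmat m₁ m₂ m₃ t)⁻¹)ᵀ * (Phᵀ * V) := by
    simp only [Matrix.transpose_mul, Matrix.mul_assoc]
  rw [e1, e2, ← Matrix.mul_add, hP, Matrix.mul_fromCols, Matrix.mul_zero]
  congr 1
  rw [Matrix.mul_assoc _ _ (_ * Y), ← Matrix.mul_assoc _ _ Y, ← Matrix.transpose_mul,
    Matrix.mul_nonsing_inv _ hd, Matrix.transpose_one, Matrix.one_mul]

lemma fin1 (m₁ m₂ m₃ : ℕ) (z₁ z₂ : ℂ) (l : Fin m₃) (y : Fin m₂ × Fin m₃) :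
    (Up m₃ * (Sm m₁ m₂ m₃ z₁ z₂)ᵀ * ((M21 m₁ m₂ m₃)ᵀ * (Up m₂ ⊗ₖ Up m₃))) l y =
      (∑ i, ss m₁ z₁ i) * ss m₂ z₂ (Fin.rev y.1) * if l = y.2 then 1 else 0 := by
  rw [← Matrix.mul_assoc, mul_V_s18, Matrix.mul_assoc, Up_mul, ← Matrix.transpose_mul,
    Matrix.transpose_apply]
  simp only [Matrix.mul_apply, Sm_apply, M21, Matrix.of_apply, Fintype.sum_prod_type]
  simp only [ite_and, ite_mul, one_mul, zero_mul, Finset.sum_ite_eq, Finset.mem_univ, if_true,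
    Finset.sum_const_zero, Finset.sum_ite_irrel, Fin.rev_inj]
  simp [Finset.sum_mul, eq_comm]

lemma fin2 (m₁ m₂ m₃ : ℕ) (z₁ z₂ : ℂ) (l : Fin m₃) (y : Fin m₁ × Fin m₃) :
    (Up m₃ * (Sm m₁ m₂ m₃ z₁ z₂)ᵀ * ((M22 m₁ m₂ m₃)ᵀ * (Up m₁ ⊗ₖ Up m₃))) l y =
      (∑ i, ss m₂ z₂ i) * ss m₁ z₁ (Fin.rev y.1) * if l = y.2 then 1 else 0 := by
  rw [← Matrix.mul_assoc, mul_V_s18, Matrix.mul_assoc, Up_mul, ← Matrix.transpose_mul,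
    Matrix.transpose_apply]
  simp only [Matrix.mul_apply, Sm_apply, M22, Matrix.of_apply, Fintype.sum_prod_type]
  simp only [ite_and, ite_mul, one_mul, zero_mul, Finset.sum_ite_eq, Finset.mem_univ, if_true,
    Finset.sum_const_zero, Finset.sum_ite_irrel, Fin.rev_inj]
  simp [Finset.sum_mul, eq_comm, mul_comm]

lemma corr (n m₃ : ℕ) (s : Fin n → ℂ) (l : Fin m₃) (y : Fin n × Fin m₃) :
    (Up m₃ * (Matrix.fromRows (0 : Matrix (Fin n × Fin m₃) (Fin m₃) ℂ) (colKronId m₃ s))ᵀ *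
      Utilde n m₃) l (Sum.inl y) = s (Fin.rev y.1) * if l = y.2 then 1 else 0 := by
  rw [Matrix.mul_assoc, Matrix.transpose_fromRows, Utilde, Matrix.fromCols_mul_fromBlocks,
    Up_mul, Matrix.fromCols_apply_inl, Matrix.mul_zero, zero_add, mul_V_s18]
  simp [colKronId, eq_comm]

lemma corr' (n m₃ : ℕ) (s : Fin n → ℂ) (l : Fin m₃) (y : Fin n × Fin m₃) :
    (Up m₃ * (Matrix.fromRows (0 : Matrix (Fin n × Fin m₃) (Fin m₃) ℂ) (colKronId m₃ s))ᵀ *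
      Utilde n m₃) l (Sum.inr y) = 0 := by
  rw [Matrix.mul_assoc, Matrix.transpose_fromRows, Utilde, Matrix.fromCols_mul_fromBlocks,
    Up_mul, Matrix.fromCols_apply_inr]
  simp

/-- Theorem 4.1, first part: For an invertible DSTU block TBT-matrix `T`,
`u_p(μ) = -q(μ) U₃ û_p(μ)ᵀ Ũ_k` for `{k, p} = {1, 2}`, `k ≠ p`. -/
theorem statement18 (m₁ m₂ m₃ : ℕ) (hm₁ : 2 ≤ m₁) (hm₂ : 2 ≤ m₂) (hm₃ : 2 ≤ m₃)
    (t : ℤ → ℤ → Matrix (Fin m₃) (Fin m₃) ℂ) (hD : DSTU m₃ t)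
    (hT : IsUnit (Tmat m₁ m₂ m₃ t))
    (mu₁ mu₂ : ℂ)
    (hmu₁ : mu₁ ≠ Complex.I / 2) (hmu₁' : mu₁ ≠ -(Complex.I / 2))
    (hmu₂ : mu₂ ≠ Complex.I / 2) (hmu₂' : mu₂ ≠ -(Complex.I / 2)) :
    u1 m₁ m₂ m₃ t mu₁ mu₂ =
      (-qfun m₁ m₂ mu₁ mu₂) • (Up m₃ * (uhat1 m₁ m₂ m₃ t mu₁ mu₂)ᵀ * Utilde m₂ m₃) ∧
    u2 m₁ m₂ m₃ t mu₁ mu₂ =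
      (-qfun m₁ m₂ mu₁ mu₂) • (Up m₃ * (uhat2 m₁ m₂ m₃ t mu₁ mu₂)ᵀ * Utilde m₁ m₃) := by
  have a1 := core_s18 t hD hT mu₁ mu₂ hmu₁ hmu₁' hmu₂ hmu₂' _ _ _ _ (Pi1_eq m₁ m₂ m₃ t hD)
  have a2 := core_s18 t hD hT mu₁ mu₂ hmu₁ hmu₁' hmu₂ hmu₂' _ _ _ _ (Pi2_eq m₁ m₂ m₃ t hD)
  have hq : qfun m₁ m₂ mu₁ mu₂ = cc m₁ mu₁ * cc m₂ mu₂ := rfl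
  have c1 := cc_ss m₁ mu₁ hmu₁ hmu₁'
  have c2 := cc_ss m₂ mu₂ hmu₂ hmu₂'
  have r1 := rr_eq m₁ mu₁ hmu₁ hmu₁'
  have r2 := rr_eq m₂ mu₂ hmu₂ hmu₂'
  constructor
  · have hv : vhat1 m₁ m₂ m₃ t mu₁ mu₂ =
        Pihat1 m₁ m₂ m₃ t * (Tmat m₁ m₂ m₃ t)⁻¹ * Sm m₁ m₂ m₃ mu₁ mu₂ := by
      simp only [vhat1, Gammahat1, Sm, Matrix.mul_assoc]
    have hw : v1 m₁ m₂ m₃ t mu₁ mu₂ =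
        Wm m₁ m₂ m₃ mu₁ mu₂ * ((Tmat m₁ m₂ m₃ t)⁻¹ * Pi1 m₁ m₂ m₃ t) := rfl
    rw [← hv, ← hw] at a1
    rw [u1, uhat1, Matrix.transpose_add, Matrix.transpose_smul, Matrix.mul_add, Matrix.add_mul,
      Matrix.mul_smul, Matrix.smul_mul]
    ext l (y | y)
    · have b := congrFun (congrFun a1 l) (Sum.inl y)
      have d := corr m₂ m₃ (ss m₂ mu₂) l y
      rw [ss] at d
      simp only [Matrix.add_apply, Matrix.smul_apply, Matrix.sub_apply, smul_eq_mul,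
        Matrix.fromCols_apply_inl] at b ⊢
      rw [fin1] at b
      rw [d]
      have e : rowKronId m₃ (Matrix.vecMul (fun _ : Fin m₂ => (1 : ℂ))
        (((calA m₂)ᴴ - mu₂ • 1)⁻¹)) l y = rr m₂ mu₂ y.1 * if l = y.2 then 1 else 0 := rfl
      have d2 : ((calA m₂ - mu₂ • 1)⁻¹ *ᵥ fun _ => (1 : ℂ)) (Fin.rev y.1) =
        ss m₂ mu₂ (Fin.rev y.1) := rfl
      rw [e, r2, d2]
      rw [hq] at b ⊢
      linear_combination b + (cc m₂ mu₂ * ss m₂ mu₂ (Fin.rev y.1) *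
        if l = y.2 then 1 else 0) * c1
    · have b := congrFun (congrFun a1 l) (Sum.inr y)
      simp only [Matrix.add_apply, Matrix.smul_apply, Matrix.sub_apply, smul_eq_mul,
        Matrix.fromCols_apply_inr, Matrix.zero_apply] at b ⊢
      rw [corr']
      linear_combination b
  · have hv : vhat2 m₁ m₂ m₃ t mu₁ mu₂ =
        Pihat2 m₁ m₂ m₃ t * (Tmat m₁ m₂ m₃ t)⁻¹ * Sm m₁ m₂ m₃ mu₁ mu₂ := by
      simp only [vhat2, Gammahat2, Sm, Matrix.mul_assoc]
    have hw : v2 m₁ m₂ m₃ t mu₁ mu₂ =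
        Wm m₁ m₂ m₃ mu₁ mu₂ * ((Tmat m₁ m₂ m₃ t)⁻¹ * Pi2 m₁ m₂ m₃ t) := rfl
    rw [← hv, ← hw] at a2
    rw [u2, uhat2, Matrix.transpose_add, Matrix.transpose_smul, Matrix.mul_add, Matrix.add_mul,
      Matrix.mul_smul, Matrix.smul_mul]
    ext l (y | y)
    · have b := congrFun (congrFun a2 l) (Sum.inl y)
      have d := corr m₁ m₃ (ss m₁ mu₁) l y
      rw [ss] at d
      simp only [Matrix.add_apply, Matrix.smul_apply, Matrix.sub_apply, smul_eq_mul,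
        Matrix.fromCols_apply_inl] at b ⊢
      rw [fin2] at b
      rw [d]
      have e : rowKronId m₃ (Matrix.vecMul (fun _ : Fin m₁ => (1 : ℂ))
        (((calA m₁)ᴴ - mu₁ • 1)⁻¹)) l y = rr m₁ mu₁ y.1 * if l = y.2 then 1 else 0 := rfl
      have d2 : ((calA m₁ - mu₁ • 1)⁻¹ *ᵥ fun _ => (1 : ℂ)) (Fin.rev y.1) =
        ss m₁ mu₁ (Fin.rev y.1) := rfl
      rw [e, r1, d2]
      rw [hq] at b ⊢
      linear_combination b + (cc m₁ mu₁ * ss m₁ mu₁ (Fin.rev y.1) *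
        if l = y.2 then 1 else 0) * c2
    · have b := congrFun (congrFun a2 l) (Sum.inr y)
      simp only [Matrix.add_apply, Matrix.smul_apply, Matrix.sub_apply, smul_eq_mul,
        Matrix.fromCols_apply_inr, Matrix.zero_apply] at b ⊢
      rw [corr']
      linear_combination b

end TBT
end
end
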